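/- arXiv:0809.0180 — 5 statements merged into one kernel-verified Lean document; each statement's English description precedes it below -/
import Mathlib

section
/- Let m ≥ 0 and n be integers and let a = (a_0,…,a_m) ∈ fil_n W_{m+1}(K); set α = α(a). Then W_{m+1}(u)(a) − W_{m+1}(v)(a) − V^m( Σ_{i=1}^{p−1} v(t^i·α^{(i−1)}/i!)·(t^r·θ)^i ) lies in fil_{n−pr} W_{m+1}(L), where the difference is taken in the ring W_{m+1}(L). -/
/-!
Setting: `p > 2` a prime, `k` a perfect field of characteristic `p`,
`K = k((t))` the field of formal Laurent series, `ord` the `t`-adic valuation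
(with `ord 0 = +∞`, encoded below via the predicate `ordGe`),
`L = k(θ)((t))` with `k(θ) = RatFunc k`.
-/

noncomputable section

namespace LFT

variable {F : Type*} [Field F]

/-- The formal derivative of a Laurent series: the coefficient of `t^j` in `lsDeriv x`
is `(j+1)` times the coefficient of `t^{j+1}` in `x`. -/
def lsDeriv (x : LaurentSeries F) : LaurentSeries F where
  coeff j := (j + 1) • x.coeff (j + 1)
  isPWO_support' := by
    have h : Function.support (fun j : ℤ => (j + 1) • x.coeff (j + 1)) ⊆
        (fun j : ℤ => j - 1) '' Function.support x.coeff := by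
      intro j hj
      refine ⟨j + 1, ?_, by ring⟩
      intro h0
      simp [Function.mem_support, h0] at hj
    exact (x.isPWO_support'.image_of_monotone (fun a b hab => by omega)).mono h

/-- The uniformizer `t` of `F((t))`. -/
def tt : LaurentSeries F := HahnSeries.single 1 1

/-- `ordGe x N` means `ord x ≥ N`, with the convention `ord 0 = +∞`. -/
def ordGe (x : LaurentSeries F) (N : ℤ) : Prop := x = 0 ∨ N ≤ x.order

/-- The element `θ` of `k(θ) ⊆ k(θ)((t))`. -/
def θθ (k : Type*) [Field k] : LaurentSeries (RatFunc k) := HahnSeries.single 0 RatFunc.X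

/-- Membership in the level `N` of the Kato filtration `fil_N W_{m+1}(F((t)))`:
`p^{m-i}·ord(a_i) ≥ -N` for all `0 ≤ i ≤ m` (with `ord 0 = +∞`). -/
def inFil (p : ℕ) {m : ℕ} (N : ℤ) (a : TruncatedWittVector p (m + 1) (LaurentSeries F)) : Prop :=
  ∀ i : Fin (m + 1), a.coeff i = 0 ∨ -N ≤ (p : ℤ) ^ (m - (i : ℕ)) * (a.coeff i).order

/-- `α(a) = Σ_{i=0}^m a_i^{p^{m-i}-1}·a_i'`, so that `F^m d(a) = α(a)·dt`. -/
def alphaW (p : ℕ) {m : ℕ} (a : TruncatedWittVector p (m + 1) (LaurentSeries F)) :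
    LaurentSeries F :=
  ∑ i : Fin (m + 1), a.coeff i ^ (p ^ (m - (i : ℕ)) - 1) * lsDeriv (a.coeff i)

/-- The componentwise map `W_{m+1}(f)` on truncated Witt vectors induced by `f`. -/
def mapTW (p : ℕ) {m : ℕ} {K L : Type*} (f : K → L)
    (a : TruncatedWittVector p (m + 1) K) : TruncatedWittVector p (m + 1) L :=
  TruncatedWittVector.mk p fun i => f (a.coeff i)

/-- `V^m(z) = (0, …, 0, z)` in `W_{m+1}(L)`. -/
def Vm (p : ℕ) {m : ℕ} {L : Type*} [Zero L] (z : L) : TruncatedWittVector p (m + 1) L :=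
  TruncatedWittVector.mk p fun i => if (i : ℕ) = m then z else 0



/-! ### Basic facts on orders -/

/-- `Ge x N`: the order of `x` is at least `N`. -/
def Ge (x : LaurentSeries F) (N : ℤ) : Prop := (N : WithTop ℤ) ≤ x.orderTop

lemma ge_iff (x : LaurentSeries F) (N : ℤ) : Ge x N ↔ (x = 0 ∨ N ≤ x.order) := by
  unfold Ge
  by_cases h : x = 0
  · simp [h]
  · rw [← HahnSeries.order_eq_orderTop_of_ne_zero h]
    simp [h]

lemma ge_iff_coeff (x : LaurentSeries F) (N : ℤ) : Ge x N ↔ ∀ j < N, x.coeff j = 0 := by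
  unfold Ge
  rw [HahnSeries.le_orderTop_iff_forall]
  simp

lemma Ge.zero (N : ℤ) : Ge (0 : LaurentSeries F) N := by simp [Ge]

lemma Ge.mono {x : LaurentSeries F} {M N : ℤ} (h : Ge x N) (hMN : M ≤ N) : Ge x M :=
  le_trans (by exact_mod_cast hMN) h

lemma Ge.add {x y : LaurentSeries F} {N : ℤ} (hx : Ge x N) (hy : Ge y N) : Ge (x + y) N := by
  rw [ge_iff_coeff] at *
  intro j hj
  simp [hx j hj, hy j hj]

lemma Ge.neg {x : LaurentSeries F} {N : ℤ} (hx : Ge x N) : Ge (-x) N := by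
  rw [ge_iff_coeff] at *
  intro j hj
  simp [hx j hj]

lemma Ge.sub {x y : LaurentSeries F} {N : ℤ} (hx : Ge x N) (hy : Ge y N) : Ge (x - y) N := by
  rw [sub_eq_add_neg]; exact hx.add hy.neg

lemma Ge.sum {ι : Type*} {s : Finset ι} {f : ι → LaurentSeries F} {N : ℤ}
    (h : ∀ i ∈ s, Ge (f i) N) : Ge (∑ i ∈ s, f i) N :=
  Finset.sum_induction f (fun x => Ge x N) (fun _ _ => Ge.add) (Ge.zero N) h

lemma Ge.mul {x y : LaurentSeries F} {M N : ℤ} (hx : Ge x M) (hy : Ge y N) :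
    Ge (x * y) (M + N) := by
  unfold Ge at *
  rw [HahnSeries.orderTop_mul]
  push_cast
  exact add_le_add hx hy

lemma Ge.one : Ge (1 : LaurentSeries F) 0 := by
  simp [Ge]

lemma Ge.pow {x : LaurentSeries F} {N : ℤ} (hx : Ge x N) (i : ℕ) : Ge (x ^ i) (i * N) := by
  induction i with
  | zero => simpa using Ge.one
  | succ i ih =>
    rw [pow_succ]
    convert ih.mul hx using 1
    push_cast; ring

lemma Ge.single (a : ℤ) (c : F) : Ge (HahnSeries.single a c) a := HahnSeries.orderTop_single_le

lemma Ge.natCast (i : ℕ) : Ge (i : LaurentSeries F) 0 := Ge.single 0 (i : F)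

lemma Ge.intCast (i : ℤ) : Ge (i : LaurentSeries F) 0 := Ge.single 0 (i : F)

lemma ge_tt : Ge (tt : LaurentSeries F) 1 := Ge.single 1 1

lemma tt_ne : (tt : LaurentSeries F) ≠ 0 := HahnSeries.single_ne_zero one_ne_zero

lemma order_inv {x : LaurentSeries F} (hx : x ≠ 0) : x⁻¹.order = -x.order := by
  have h := HahnSeries.order_mul hx (inv_ne_zero hx)
  rw [mul_inv_cancel₀ hx, HahnSeries.order_one] at h
  linarith

lemma ge_order (x : LaurentSeries F) : Ge x x.order := by rw [ge_iff]; simp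

lemma ge_inv {x : LaurentSeries F} (hx : x ≠ 0) : Ge x⁻¹ (-x.order) := by
  rw [← order_inv hx]; exact ge_order _

lemma Ge.natCast_inv (i : ℕ) : Ge ((i : LaurentSeries F)⁻¹) 0 := by
  have : ((i : LaurentSeries F)⁻¹) = HahnSeries.single 0 ((i : F)⁻¹) := by
    rw [← HahnSeries.single_zero_natCast]
    simp [HahnSeries.inv_single]
  rw [this]; exact Ge.single _ _

/-- The subring of integral elements. -/
def OO (F : Type*) [Field F] : Subring (LaurentSeries F) where
  carrier := {x | Ge x 0}
  mul_mem' := fun h1 h2 => by simpa using Ge.mul h1 h2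
  one_mem' := Ge.one
  add_mem' := fun h1 h2 => Ge.add h1 h2
  zero_mem' := Ge.zero 0
  neg_mem' := fun h1 => Ge.neg h1

lemma mem_OO {x : LaurentSeries F} : x ∈ OO F ↔ Ge x 0 := Iff.rfl

/-- Evaluation of an integer polynomial. -/
def ev {R : Type*} [CommRing R] (a : R) : Polynomial ℤ →+* R :=
  Polynomial.eval₂RingHom (Int.castRingHom R) a

lemma hom_ev {R S : Type*} [CommRing R] [CommRing S] (g : R →+* S) (a : R) (f : Polynomial ℤ) :
    g (ev a f) = ev (g a) f := by
  have : g.comp (ev a) = ev (g a) := by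
    apply Polynomial.ringHom_ext
    · intro n; simp [ev]
    · simp [ev]
  exact congrArg (fun h => h f) this

lemma sub_dvd_ev_sub {R : Type*} [CommRing R] (a b : R) (f : Polynomial ℤ) :
    a - b ∣ ev a f - ev b f := by
  have := Polynomial.sub_dvd_eval_sub a b (f.map (Int.castRingHom R))
  simpa [Polynomial.eval_map, ev] using this

lemma ge_ev_sub (f : Polynomial ℤ) {a b : LaurentSeries F} (ha : Ge a 0) (hb : Ge b 0)
    {N : ℤ} (h : Ge (a - b) N) : Ge (ev a f - ev b f) N := by
  obtain ⟨c, hc⟩ := sub_dvd_ev_sub (⟨a, ha⟩ : OO F) ⟨b, hb⟩ f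
  have h1 := hom_ev (OO F).subtype (⟨a, ha⟩ : OO F) f
  have h2 := hom_ev (OO F).subtype (⟨b, hb⟩ : OO F) f
  have h3 := congrArg (OO F).subtype hc
  rw [map_sub, h1, h2, map_mul, map_sub] at h3
  simp only [Subring.subtype_apply] at h3
  rw [h3]
  simpa using h.mul (mem_OO.1 c.2)

/-! ### The derivative -/

/-- Euler operator `t d/dt`. -/
def euler (x : LaurentSeries F) : LaurentSeries F where
  coeff j := j • x.coeff j
  isPWO_support' := by
    refine x.isPWO_support'.mono ?_
    intro j hj h0
    exact hj (by simp [show x.coeff j = 0 from h0])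

lemma euler_mul (x y : LaurentSeries F) : euler (x * y) = euler x * y + x * euler y := by
  ext j
  have hx : (euler x).support ⊆ x.support := by
    intro j hj h0
    exact hj (by simp [euler, show x.coeff j = 0 from h0])
  have hy : (euler y).support ⊆ y.support := by
    intro j hj h0
    exact hj (by simp [euler, show y.coeff j = 0 from h0])
  rw [HahnSeries.coeff_add, HahnSeries.coeff_mul_left' x.isPWO_support hx,
    HahnSeries.coeff_mul_right' y.isPWO_support hy, ← Finset.sum_add_distrib]
  change j • (x * y).coeff j = _
  rw [HahnSeries.coeff_mul, Finset.smul_sum]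
  refine Finset.sum_congr rfl ?_
  intro ij hij
  have : ij.1 + ij.2 = j := (Finset.mem_antidiagonal.1 hij).2.2
  subst this
  simp only [euler]
  simp only [zsmul_eq_mul]
  push_cast; ring

lemma tt_mul_lsDeriv (x : LaurentSeries F) : tt * lsDeriv x = euler x := by
  ext j
  rw [tt, show j = (j - 1) + 1 by ring, add_comm (j-1) 1, HahnSeries.coeff_single_mul]
  simp [lsDeriv, euler]

lemma lsDeriv_add (x y : LaurentSeries F) : lsDeriv (x + y) = lsDeriv x + lsDeriv y := by
  ext j
  simp [lsDeriv]

lemma lsDeriv_mul (x y : LaurentSeries F) :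
    lsDeriv (x * y) = lsDeriv x * y + x * lsDeriv y := by
  apply mul_left_cancel₀ (tt_ne (F := F))
  rw [mul_add, ← mul_assoc, mul_left_comm, tt_mul_lsDeriv, tt_mul_lsDeriv, tt_mul_lsDeriv,
    euler_mul]

lemma lsDeriv_one : lsDeriv (1 : LaurentSeries F) = 0 := by
  have := lsDeriv_mul (1 : LaurentSeries F) 1
  simpa using this

lemma lsDeriv_pow (x : LaurentSeries F) (n : ℕ) :
    lsDeriv (x ^ (n + 1)) = (n + 1 : ℕ) * x ^ n * lsDeriv x := by
  induction n with
  | zero => simp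
  | succ n ih => rw [pow_succ, lsDeriv_mul, ih]; push_cast; ring

lemma lsDeriv_single (j : ℤ) (c : F) :
    lsDeriv (HahnSeries.single j c) = HahnSeries.single (j - 1) (j * c) := by
  ext i
  simp only [lsDeriv, HahnSeries.coeff_single]
  by_cases h : i + 1 = j
  · subst h; simp
  · rw [if_neg h, if_neg (by omega)]; simp

lemma iter_add (i : ℕ) (x y : LaurentSeries F) :
    lsDeriv^[i] (x + y) = lsDeriv^[i] x + lsDeriv^[i] y := by
  induction i generalizing x y with
  | zero => rfl
  | succ i ih => simp only [Function.iterate_succ_apply, lsDeriv_add, ih]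

lemma iter_zero (i : ℕ) : lsDeriv^[i] (0 : LaurentSeries F) = 0 := by
  have := iter_add i (0 : LaurentSeries F) 0
  simpa using this

lemma Ge.lsDeriv {x : LaurentSeries F} {N : ℤ} (h : Ge x N) : Ge (lsDeriv x) (N - 1) := by
  rw [ge_iff_coeff] at *
  intro j hj
  simp [LFT.lsDeriv, h (j + 1) (by omega)]

lemma Ge.iter {x : LaurentSeries F} {N : ℤ} (h : Ge x N) (i : ℕ) :
    Ge (LFT.lsDeriv^[i] x) (N - i) := by
  induction i with
  | zero => simpa using h
  | succ i ih =>
    rw [Function.iterate_succ_apply']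
    convert ih.lsDeriv using 1
    push_cast; ring

/-- Divided Taylor coefficients: `x^{(i)}/i!`. -/
def tc (x : LaurentSeries F) (i : ℕ) : LaurentSeries F :=
  lsDeriv^[i] x / (Nat.factorial i : LaurentSeries F)

lemma Ge.tc {x : LaurentSeries F} {N : ℤ} (h : Ge x N) (i : ℕ) : Ge (tc x i) (N - i) := by
  unfold LFT.tc
  rw [div_eq_mul_inv]
  simpa using (h.iter i).mul (Ge.natCast_inv _)

lemma tc_add (x y : LaurentSeries F) (i : ℕ) : tc (x + y) i = tc x i + tc y i := by
  simp only [tc, iter_add, add_div]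

lemma tc_zero (x : LaurentSeries F) : tc x 0 = x := by simp [tc]

instance charP_ls (p : ℕ) [CharP F p] : CharP (LaurentSeries F) p :=
  charP_of_injective_ringHom (f := (HahnSeries.C : F →+* LaurentSeries F))
    HahnSeries.C_injective p

lemma tc_deriv {p : ℕ} [Fact p.Prime] [CharP F p] (x : LaurentSeries F) (i : ℕ) (hi : i + 1 < p) :
    tc (lsDeriv x) i = (i + 1 : ℕ) * tc x (i + 1) := by
  unfold tc
  rw [← Function.iterate_succ_apply, Nat.factorial_succ]
  have : ((i + 1 : ℕ) : LaurentSeries F) ≠ 0 := by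
    intro h
    rw [CharP.cast_eq_zero_iff _ p] at h
    exact absurd (Nat.le_of_dvd (by omega) h) (by omega)
  have h2 : ((i.factorial : ℕ) : LaurentSeries F) ≠ 0 := by
    intro h
    rw [CharP.cast_eq_zero_iff _ p, (Fact.out : p.Prime).dvd_factorial] at h
    omega
  push_cast at this ⊢
  field_simp

/-- Leibniz rule for Taylor coefficients. -/
lemma tc_mul {p : ℕ} [Fact p.Prime] [CharP F p] (i : ℕ) (hi : i < p) : ∀ (x y : LaurentSeries F),
    tc (x * y) i = ∑ ab ∈ Finset.HasAntidiagonal.antidiagonal i, tc x ab.1 * tc y ab.2 := by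
  induction i with
  | zero => intro x y; simp [tc_zero]
  | succ i ih =>
    intro x y
    have hne : ((i + 1 : ℕ) : LaurentSeries F) ≠ 0 := by
      intro h
      rw [CharP.cast_eq_zero_iff _ p] at h
      exact absurd (Nat.le_of_dvd (by omega) h) (by omega)
    apply mul_left_cancel₀ hne
    rw [← tc_deriv (p := p) _ _ hi, lsDeriv_mul, tc_add, ih (by omega), ih (by omega)]
    have h1 : ∑ ab ∈ Finset.HasAntidiagonal.antidiagonal (i + 1), (ab.1 : LaurentSeries F) * (tc x ab.1 * tc y ab.2)
        = ∑ ab ∈ Finset.HasAntidiagonal.antidiagonal i, tc (lsDeriv x) ab.1 * tc y ab.2 := by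
      rw [Finset.Nat.sum_antidiagonal_succ]
      simp only [Nat.cast_zero, zero_mul, zero_add]
      refine Finset.sum_congr rfl fun ab hab => ?_
      have := Finset.HasAntidiagonal.mem_antidiagonal.1 hab
      rw [tc_deriv (p := p) _ _ (by omega)]; ring
    have h2 : ∑ ab ∈ Finset.HasAntidiagonal.antidiagonal (i + 1), (ab.2 : LaurentSeries F) * (tc x ab.1 * tc y ab.2)
        = ∑ ab ∈ Finset.HasAntidiagonal.antidiagonal i, tc x ab.1 * tc (lsDeriv y) ab.2 := by
      rw [Finset.Nat.sum_antidiagonal_succ']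
      simp only [Nat.cast_zero, zero_mul, zero_add]
      refine Finset.sum_congr rfl fun ab hab => ?_
      have := Finset.HasAntidiagonal.mem_antidiagonal.1 hab
      rw [tc_deriv (p := p) _ _ (by omega)]; ring
    rw [← h1, ← h2, ← Finset.sum_add_distrib, Finset.mul_sum]
    refine Finset.sum_congr rfl fun ab hab => ?_
    have := Finset.HasAntidiagonal.mem_antidiagonal.1 hab
    rw [← this]; push_cast; ring

/-! ### Taylor expansion of `u` -/

lemma tt_zpow (j : ℤ) : (tt : LaurentSeries F) ^ j = HahnSeries.single j 1 := by
  rw [tt]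
  induction j using Int.induction_on with
  | zero => simp
  | succ i ih =>
    rw [zpow_add₀ (HahnSeries.single_ne_zero one_ne_zero), ih, zpow_one,
      HahnSeries.single_mul_single, one_mul]
  | pred i ih =>
    rw [zpow_sub₀ (HahnSeries.single_ne_zero one_ne_zero), ih, zpow_one, div_eq_mul_inv,
      HahnSeries.inv_single, HahnSeries.single_mul_single]
    simp [sub_eq_add_neg]

lemma single_eq (j : ℤ) (c : F) :
    (HahnSeries.single j c : LaurentSeries F) = HahnSeries.single 0 c * tt ^ j := by
  rw [tt_zpow, HahnSeries.single_mul_single]; simp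

lemma iter_single (j : ℤ) (c : F) (i : ℕ) :
    lsDeriv^[i] (HahnSeries.single j c) =
      (∏ l ∈ Finset.range i, ((j : LaurentSeries F) - (l : LaurentSeries F))) *
        HahnSeries.single (j - i) c := by
  induction i with
  | zero => simp
  | succ i ih =>
    have hz : lsDeriv (∏ l ∈ Finset.range i, ((j : LaurentSeries F) - (l : LaurentSeries F))) = 0 := by
      have : (∏ l ∈ Finset.range i, ((j : LaurentSeries F) - (l : LaurentSeries F))) =
          HahnSeries.single 0 (((∏ l ∈ Finset.range i, (j - (l : ℤ)) : ℤ)) : F) := by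
        rw [HahnSeries.single_zero_intCast]; push_cast; rfl
      rw [this, lsDeriv_single]; simp
    rw [Function.iterate_succ_apply', ih, lsDeriv_mul, hz, lsDeriv_single, Finset.prod_range_succ,
      zero_mul, zero_add, mul_assoc]
    congr 1
    have : ((j : LaurentSeries F) - (i : LaurentSeries F)) =
        HahnSeries.single 0 ((j : F) - (i : F)) := by
      rw [← HahnSeries.single_zero_intCast, ← HahnSeries.single_zero_natCast, ← HahnSeries.single_sub]
    rw [this, HahnSeries.single_mul_single]
    push_cast
    congr 1
    ring_nf

lemma prod_cast_eq {R : Type*} [CommRing R] (p : ℕ) [CharP R p] (j : ℤ) (j0 : ℕ) (q : ℤ)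
    (hj : j = j0 + p * q) (i : ℕ) :
    (∏ l ∈ Finset.range i, ((j : R) - (l : R))) = (j0.choose i : R) * (i.factorial : R) := by
  have : (j : R) = (j0 : R) := by rw [hj]; push_cast; simp
  rw [this, ← descPochhammer_eval_eq_prod_range, descPochhammer_eval_eq_descFactorial,
    Nat.descFactorial_eq_factorial_mul_choose]
  push_cast; ring

lemma ge_zpow_sub_one {y : LaurentSeries F} {N : ℤ} (hN : 0 < N) (h : Ge (y - 1) N) (q : ℤ) :
    Ge (y ^ q - 1) N := by
  have hnat : ∀ n : ℕ, Ge (y ^ n - 1) N := by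
    intro n
    have h1 : Ge y 0 := by
      have := (h.mono hN.le).add Ge.one
      simpa using this
    induction n with
    | zero => simpa using Ge.zero N
    | succ n ih =>
      have : y ^ (n + 1) - 1 = (y ^ n - 1) * y + (y - 1) := by ring
      rw [this]
      exact (by simpa using ih.mul h1 : Ge _ N).add h
  obtain ⟨n, rfl | rfl⟩ := q.eq_nat_or_neg
  · simpa using hnat n
  · have hn := hnat n
    set z := y ^ n with hz
    have hc : z.coeff 0 = 1 := by
      have := (ge_iff_coeff _ _).1 hn 0 hN
      simpa [sub_eq_zero] using this
    have hz0 : z ≠ 0 := by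
      intro h0; rw [h0] at hc; simp at hc
    have ho : 0 ≤ -z.order := by
      have := HahnSeries.order_le_of_coeff_ne_zero (x := z) (g := 0) (by rw [hc]; exact one_ne_zero)
      linarith
    have : y ^ (-(n : ℤ)) - 1 = -((z - 1) * z⁻¹) := by
      rw [zpow_neg, zpow_natCast, ← hz]
      field_simp
      ring
    rw [this]
    have := hn.mul ((ge_inv hz0).mono ho)
    simpa using this.neg

section taylor

variable {k : Type*} [Field k] (p : ℕ) [Fact p.Prime] [CharP k p]

lemma factorial_ne_zero' {R : Type*} [Field R] (p : ℕ) [Fact p.Prime] [CharP R p] {i : ℕ}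
    (hi : i < p) : (i.factorial : R) ≠ 0 := by
  intro h
  rw [CharP.cast_eq_zero_iff _ p, (Fact.out : p.Prime).dvd_factorial] at h
  omega

lemma ge_s (r : ℕ) : Ge ((tt : LaurentSeries (RatFunc k)) ^ r * θθ k) r := by
  have := ((ge_tt (F := RatFunc k)).pow r).mul (Ge.single 0 (RatFunc.X : RatFunc k))
  unfold θθ
  simpa using this

lemma ge_v {v : LaurentSeries k →+* LaurentSeries (RatFunc k)}
    (hv : ∀ (x : LaurentSeries k) (j : ℤ),
      (v x).coeff j = algebraMap k (RatFunc k) (x.coeff j)) {x : LaurentSeries k} {N : ℤ}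
    (h : Ge x N) : Ge (v x) N := by
  rw [ge_iff_coeff] at *
  intro j hj
  rw [hv, h j hj, map_zero]

lemma taylor_single (r : ℕ) (hr : 1 ≤ r)
    (u v : LaurentSeries k →+* LaurentSeries (RatFunc k))
    (hv : ∀ (x : LaurentSeries k) (j : ℤ),
      (v x).coeff j = algebraMap k (RatFunc k) (x.coeff j))
    (hu_alg : ∀ c : k,
      u (HahnSeries.single 0 c) = HahnSeries.single 0 (algebraMap k (RatFunc k) c))
    (hu_t : u tt = tt * (1 + tt ^ r * θθ k)) (j : ℤ) (c : k) :
    Ge (u (HahnSeries.single j c) - ∑ i ∈ Finset.range p, v (tc (HahnSeries.single j c) i) *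
      (tt * (tt ^ r * θθ k)) ^ i) (j + p * r) := by
  have : CharP (RatFunc k) p := charP_of_injective_ringHom (algebraMap k (RatFunc k)).injective p
  have hp : p.Prime := Fact.out
  set s : LaurentSeries (RatFunc k) := tt ^ r * θθ k with hs
  have hsr : Ge s r := ge_s r
  have hp0 : (p : ℤ) ≠ 0 := by exact_mod_cast hp.ne_zero
  obtain ⟨j0, hj0⟩ := Int.eq_ofNat_of_zero_le (Int.emod_nonneg j hp0)
  have hlt : j0 < p := by
    have := Int.emod_lt_of_pos j (b := p) (by exact_mod_cast hp.pos)
    omega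
  set q := j / p with hq
  have hj : j = j0 + p * q := by
    have := Int.emod_add_mul_ediv j p
    rw [hj0] at this
    exact this.symm
  set e : LaurentSeries (RatFunc k) := HahnSeries.single 0 (algebraMap k (RatFunc k) c) with he
  have hvs : ∀ (a : ℤ) (c : k), v (HahnSeries.single a c) =
      HahnSeries.single a (algebraMap k (RatFunc k) c) := by
    intro a c
    ext i
    rw [hv]
    simp only [HahnSeries.coeff_single]
    split_ifs <;> simp
  have hu1 : u (HahnSeries.single j c) = e * (tt ^ j * (1 + s) ^ j) := by
    rw [single_eq, map_mul, hu_alg, map_zpow₀, hu_t, mul_zpow]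
  have hterm : ∀ i ∈ Finset.range p, v (tc (HahnSeries.single j c) i) * (tt * s) ^ i =
      e * tt ^ j * ((j0.choose i : LaurentSeries (RatFunc k)) * s ^ i) := by
    intro i hi
    have hf := factorial_ne_zero' (R := LaurentSeries k) p (Finset.mem_range.1 hi)
    have h1 : tc (HahnSeries.single j c) i =
        (j0.choose i : LaurentSeries k) * HahnSeries.single (j - i) c := by
      rw [tc, iter_single, prod_cast_eq p j j0 q hj]
      field_simp
    rw [h1, map_mul, map_natCast, hvs, single_eq, ← he, zpow_sub₀ tt_ne, zpow_natCast, mul_pow]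
    have : (tt : LaurentSeries (RatFunc k)) ≠ 0 := tt_ne
    field_simp
  rw [Finset.sum_congr rfl hterm, ← Finset.mul_sum]
  have hbin : ∑ i ∈ Finset.range p, (j0.choose i : LaurentSeries (RatFunc k)) * s ^ i
      = (1 + s) ^ j0 := by
    rw [add_comm 1 s, add_pow]
    symm
    apply Finset.sum_subset_zero_on_sdiff
    · intro i hi; simp at hi ⊢; omega
    · intro i hi
      simp at hi
      rw [Nat.choose_eq_zero_of_lt (by omega)]; simp
    · intro i hi; simp [mul_comm]
  rw [hbin, hu1]
  have h1s : (1 + s) ≠ 0 := by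
    intro h0
    have := congrArg (fun x => HahnSeries.coeff x 0) h0
    simp [(ge_iff_coeff _ _).1 hsr 0 (by exact_mod_cast hr)] at this
  have hpow : (1 + s) ^ j = (1 + s) ^ j0 * (1 + s ^ p) ^ q := by
    conv_lhs => rw [hj]
    rw [zpow_add₀ h1s, zpow_natCast, zpow_mul, zpow_natCast, add_pow_char (R := LaurentSeries (RatFunc k)) 1 s p, one_pow]
  rw [hpow]
  have : e * (tt ^ j * ((1 + s) ^ j0 * (1 + s ^ p) ^ q)) - e * tt ^ j * (1 + s) ^ j0 =
      e * tt ^ j * (1 + s) ^ j0 * ((1 + s ^ p) ^ q - 1) := by ring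
  rw [this]
  have hA : Ge (e * tt ^ j * (1 + s) ^ j0) j := by
    have h1 : Ge ((1 + s) ^ j0) 0 := by
      simpa using (Ge.one.add (hsr.mono (by positivity))).pow j0
    rw [tt_zpow]
    have h2 := ((Ge.single 0 (algebraMap k (RatFunc k) c)).mul (Ge.single j 1)).mul h1
    rw [← he] at h2
    simpa only [zero_add, add_zero] using h2
  refine hA.mul (ge_zpow_sub_one ?_ ?_ q)
  · have := hp.pos
    positivity
  · simpa using hsr.pow p

lemma taylor (r : ℕ) (hr : 1 ≤ r)
    (u v : LaurentSeries k →+* LaurentSeries (RatFunc k))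
    (hv : ∀ (x : LaurentSeries k) (j : ℤ),
      (v x).coeff j = algebraMap k (RatFunc k) (x.coeff j))
    (hu_alg : ∀ c : k,
      u (HahnSeries.single 0 c) = HahnSeries.single 0 (algebraMap k (RatFunc k) c))
    (hu_t : u tt = tt * (1 + tt ^ r * θθ k))
    (hu_cont : ∀ N : ℤ, ∃ M : ℤ, ∀ x : LaurentSeries k, ordGe x M → ordGe (u x) N)
    (x : LaurentSeries k) (N : ℤ) (hx : Ge x N) :
    Ge (u x - ∑ i ∈ Finset.range p, v (tc x i) * (tt * (tt ^ r * θθ k)) ^ i) (N + p * r) := by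
  set s : LaurentSeries (RatFunc k) := tt ^ r * θθ k with hs
  have hsr : Ge s r := ge_s r
  obtain ⟨M, hM⟩ := hu_cont (N + p * r)
  set M' := max M (N + p * r) with hM'
  have key : ∀ d : ℕ, ∀ x : LaurentSeries k, N ≤ M' - d → Ge x (M' - d) →
      Ge (u x - ∑ i ∈ Finset.range p, v (tc x i) * (tt * s) ^ i) (N + p * r) := by
    intro d
    induction d with
    | zero =>
      intro x _ hx
      simp only [Nat.cast_zero, sub_zero] at hx
      refine Ge.sub ?_ (Ge.sum ?_)
      · rw [ge_iff]
        exact hM x ((ge_iff _ _).1 (hx.mono (le_max_left _ _)))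
      · intro i _
        have h1 := (ge_v hv (hx.tc i)).mul ((ge_tt.mul hsr).pow i)
        refine h1.mono ?_
        have : N + p * r ≤ M' := le_max_right _ _
        have h3 : (0 : ℤ) ≤ i * r := by positivity
        linarith
    | succ d ih =>
      intro x hN hx
      set j := M' - ((d + 1 : ℕ) : ℤ) with hj
      have hx1 : Ge (x - HahnSeries.single j (x.coeff j)) (M' - d) := by
        rw [ge_iff_coeff] at hx ⊢
        intro i hi
        by_cases hij : i = j
        · subst hij; simp
        · have : i < j := by
            push_cast at hj
            omega
          simp [hx i this, HahnSeries.coeff_single_of_ne hij]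
      have h1 := ih _ (by push_cast at hj; omega) hx1
      have h2 := taylor_single p r hr u v hv hu_alg hu_t j (x.coeff j)
      have h3 := h1.add (h2.mono (by linarith))
      set y := x - HahnSeries.single j (x.coeff j) with hy
      have hxy : x = y + HahnSeries.single j (x.coeff j) := by rw [hy]; ring
      have : u x - ∑ i ∈ Finset.range p, v (tc x i) * (tt * s) ^ i =
          (u y - ∑ i ∈ Finset.range p, v (tc y i) * (tt * s) ^ i) +
          (u (HahnSeries.single j (x.coeff j)) - ∑ i ∈ Finset.range p,
            v (tc (HahnSeries.single j (x.coeff j)) i) * (tt * s) ^ i) := by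
        generalize HahnSeries.single j (x.coeff j) = z at *
        rw [hxy]
        simp only [tc_add, map_add, add_mul, Finset.sum_add_distrib]
        ring
      rw [this]
      exact h3
  by_cases hNM : N ≤ M'
  · obtain ⟨d, hd⟩ := Int.eq_ofNat_of_zero_le (sub_nonneg.2 hNM)
    have : M' - d = N := by omega
    exact key d x this.ge (this ▸ hx)
  · exfalso
    have : N + p * r ≤ M' := le_max_right _ _
    have : (0 : ℤ) ≤ p * r := by positivity
    omega

end taylor

/-! ### The components of `[1 + X] - 1` and the truncated logarithm -/

open Polynomial in
/-- The components of the Witt vector `[1 + X] - 1` over `ℤ[X]`. -/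
def cw (p : ℕ) [Fact p.Prime] (s : ℕ) : ℤ[X] :=
  (WittVector.teichmuller p (1 + X : ℤ[X]) - 1 : WittVector p ℤ[X]).coeff s

section cwsec

open Polynomial

variable (p : ℕ) [Fact p.Prime]

lemma ev_cw {R : Type*} [CommRing R] (e : R) (s : ℕ) :
    ev e (cw p s) = (WittVector.teichmuller p (1 + e) - 1 : WittVector p R).coeff s := by
  unfold cw
  rw [← WittVector.map_coeff, map_sub, WittVector.map_teichmuller, map_one]
  simp [ev]

lemma X_dvd_cw (s : ℕ) : X ∣ cw p s := by
  rw [X_dvd_iff]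
  have h := ev_cw p (0 : ℤ) s
  rw [add_zero, map_one, sub_self, WittVector.zero_coeff] at h
  rw [coeff_zero_eq_eval_zero]
  rw [ev, coe_eval₂RingHom, eval₂_eq_eval_map] at h
  simpa using h

lemma cw_ghost (s : ℕ) :
    ∑ i ∈ Finset.range (s + 1), (p : ℤ[X]) ^ i * cw p i ^ p ^ (s - i) =
      (1 + X) ^ p ^ s - 1 := by
  have h := WittVector.ghostComponent_apply s
    (WittVector.teichmuller p (1 + X : ℤ[X]) - 1 : WittVector p ℤ[X])
  rw [map_sub, WittVector.ghostComponent_teichmuller, map_one, aeval_wittPolynomial] at h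
  exact h.symm

lemma cw_deriv (s : ℕ) :
    ∑ i ∈ Finset.range (s + 1), cw p i ^ (p ^ (s - i) - 1) * derivative (cw p i) =
      (1 + X) ^ (p ^ s - 1) := by
  have h := congrArg derivative (cw_ghost p s)
  have hp : p.Prime := Fact.out
  have hp0 : (p : ℤ[X]) ^ s ≠ 0 := pow_ne_zero _ (by exact_mod_cast hp.ne_zero)
  apply mul_left_cancel₀ hp0
  rw [derivative_sum] at h
  simp only [derivative_sub, derivative_pow, derivative_one, derivative_add, derivative_X, sub_zero,
    zero_add, mul_one] at h
  push_cast at h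
  simp only [map_pow, map_natCast] at h
  rw [← h, Finset.mul_sum]
  refine Finset.sum_congr rfl ?_
  intro i hi
  have hi' : i ≤ s := by simpa [Nat.lt_succ_iff] using hi
  have h1 : derivative ((p : ℤ[X]) ^ i * cw p i ^ p ^ (s - i)) =
      (p : ℤ[X]) ^ i * ((p : ℤ[X]) ^ (s - i) * cw p i ^ (p ^ (s - i) - 1) * derivative (cw p i)) := by
    have : derivative ((p : ℤ[X]) ^ i) = 0 := by
      rw [derivative_pow]; simp
    rw [derivative_mul, this, derivative_pow]
    push_cast
    simp
  rw [h1]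
  have : (p : ℤ[X]) ^ s = (p : ℤ[X]) ^ i * (p : ℤ[X]) ^ (s - i) := by
    rw [← pow_add]; congr 1; omega
  rw [this]; ring

lemma cw_deriv_mod (s : ℕ) : ∃ g : ℤ[X],
    (1 + X) * derivative (cw p s) = (1 + X) ^ p ^ s + X ^ (p - 1) * g := by
  have hp : p.Prime := Fact.out
  have h := cw_deriv p s
  rw [Finset.sum_range_succ] at h
  have hd : X ^ (p - 1) ∣
      ∑ i ∈ Finset.range s, cw p i ^ (p ^ (s - i) - 1) * derivative (cw p i) := by
    apply Finset.dvd_sum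
    intro i hi
    apply Dvd.dvd.mul_right
    refine (pow_dvd_pow_of_dvd (X_dvd_cw p i) (p - 1)).trans (pow_dvd_pow _ ?_)
    have : p ^ 1 ≤ p ^ (s - i) := Nat.pow_le_pow_right hp.pos (by simp at hi; omega)
    rw [pow_one] at this
    omega
  obtain ⟨g, hg⟩ := hd
  refine ⟨-((1 + X) * g), ?_⟩
  rw [hg] at h
  simp only [Nat.sub_self, pow_zero, one_mul] at h
  have h2 : (1 + X : ℤ[X]) ^ p ^ s = (1 + X) * (1 + X) ^ (p ^ s - 1) := by
    rw [← pow_succ']; congr 1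
    have : 0 < p ^ s := pow_pos hp.pos _
    omega
  rw [h2, ← h]; ring

/-- Truncated polynomial with given coefficients. -/
def tpol {R : Type*} [CommRing R] (p : ℕ) (a : ℕ → R) : R[X] := ∑ i ∈ Finset.range p, C (a i) * X ^ i

lemma tpol_coeff {R : Type*} [CommRing R] (p : ℕ) (a : ℕ → R) (d : ℕ) :
    (tpol p a).coeff d = if d < p then a d else 0 := by
  simp [tpol, coeff_X_pow]

/-- Coefficients of the primitive of the Taylor expansion of `w`. -/
def gc (w : LaurentSeries F) : ℕ → LaurentSeries F
  | 0 => 0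
  | (i + 1) => lsDeriv^[i] w / ((i + 1).factorial : LaurentSeries F)

lemma log_congr [CharP F p] (x : LaurentSeries F) (hx : x ≠ 0) (s : ℕ) (hs : 1 ≤ s) :
    X ^ p ∣ ev (C x⁻¹ * tpol p (tc x) - 1) (cw p s) - tpol p (gc (lsDeriv x / x)) := by
  have hp : p.Prime := Fact.out
  have hp2 := hp.two_le
  set P := tpol p (tc x) with hP
  set E := C x⁻¹ * P - 1 with hE
  set w := lsDeriv x / x with hw
  set G := tpol p (gc w) with hG
  set Q := tpol p (tc (lsDeriv x)) with hQ
  set D := tpol p (tc w) with hD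
  have hP0 : P.coeff 0 = x := by rw [hP, tpol_coeff, if_pos hp.pos, tc_zero]
  have hPE : P = C x * (1 + E) := by
    rw [hE, add_sub_cancel, ← mul_assoc, ← C_mul, mul_inv_cancel₀ hx, C_1, one_mul]
  have hXE : X ∣ E := by
    rw [X_dvd_iff, hE]
    simp [hP0, hx]
  -- `P' ≡ Q`
  have h1 : X ^ (p - 1) ∣ derivative P - Q := by
    rw [X_pow_dvd_iff]
    intro d hd
    rw [coeff_sub, coeff_derivative, hP, hQ, tpol_coeff, tpol_coeff, if_pos (by omega),
      if_pos (by omega), tc_deriv (p := p) _ _ (by omega)]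
    push_cast; ring
  have h2 : X ^ (p - 1) ∣ derivative G - D := by
    rw [X_pow_dvd_iff]
    intro d hd
    rw [coeff_sub, coeff_derivative, hG, hD, tpol_coeff, tpol_coeff, if_pos (by omega),
      if_pos (by omega), gc, tc, Nat.factorial_succ]
    have hf := factorial_ne_zero' (R := LaurentSeries F) p (i := d + 1) (by omega)
    rw [Nat.factorial_succ] at hf
    push_cast at hf ⊢
    have ha := left_ne_zero_of_mul hf
    have hb := right_ne_zero_of_mul hf
    field_simp
    ring
  have h3 : X ^ (p - 1) ∣ P * D - Q := by
    rw [X_pow_dvd_iff]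
    intro d hd
    have hxw : x * w = lsDeriv x := by rw [hw]; field_simp
    rw [coeff_sub, coeff_mul, hQ, tpol_coeff, if_pos (by omega), ← hxw,
      tc_mul (p := p) d (by omega), sub_eq_zero]
    refine Finset.sum_congr rfl fun ab hab => ?_
    have := Finset.HasAntidiagonal.mem_antidiagonal.1 hab
    rw [hP, hD, tpol_coeff, tpol_coeff, if_pos (by omega), if_pos (by omega)]
  -- derivative of the composition
  have hcomp : ∀ c : ℤ[X], ev E c = (c.map (Int.castRingHom (LaurentSeries F))).comp E := by
    intro c
    rw [comp, eval₂_map, ev, coe_eval₂RingHom]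
    congr 1
  have hder : ∀ c : ℤ[X], derivative (ev E c) = derivative E * ev E (derivative c) := by
    intro c
    rw [hcomp, hcomp, derivative_comp, derivative_map]
  obtain ⟨g, hg⟩ := cw_deriv_mod p s
  have h4 : X ^ (p - 1) ∣ (1 + E) * ev E (derivative (cw p s)) - 1 := by
    have hg' := congrArg (ev E) hg
    simp only [map_mul, map_add, map_one, map_pow] at hg'
    have hX : ev E (X : ℤ[X]) = E := by simp [ev]
    rw [hX] at hg'
    rw [hg', add_pow_char_pow, one_pow]
    have : (1 + E ^ p ^ s + E ^ (p - 1) * ev E g - 1) = E ^ p ^ s + E ^ (p - 1) * ev E g := by ring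
    rw [this]
    refine dvd_add ?_ (Dvd.dvd.mul_right (pow_dvd_pow_of_dvd hXE _) _)
    refine (pow_dvd_pow_of_dvd hXE (p - 1)).trans (pow_dvd_pow _ ?_)
    have : p ^ 1 ≤ p ^ s := Nat.pow_le_pow_right hp.pos hs
    rw [pow_one] at this
    omega
  set f := ev E (cw p s) - G with hf
  have h5 : X ^ (p - 1) ∣ P * derivative f := by
    have hEd : C x * derivative E = derivative P := by
      rw [hPE]; simp
    have : P * derivative f = C x * derivative E * ((1 + E) * ev E (derivative (cw p s)) - 1)
        + (derivative P - Q) - (P * D - Q) - P * (derivative G - D) := by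
      rw [hf, derivative_sub, hder, hEd, ← hEd]
      rw [hPE]; ring
    rw [this]
    exact dvd_sub (dvd_sub (dvd_add (Dvd.dvd.mul_left h4 _) h1) h3) (Dvd.dvd.mul_left h2 _)
  have h6 : X ^ (p - 1) ∣ derivative f := by
    refine prime_X.pow_dvd_of_dvd_mul_left (p - 1) ?_ h5
    rw [X_dvd_iff, hP0]; exact hx
  rw [X_pow_dvd_iff] at h6 ⊢
  intro d hd
  rcases d with _ | d
  · have : X ∣ f := by
      rw [hf]
      refine dvd_sub ?_ ?_
      · obtain ⟨c, hc⟩ := X_dvd_cw p s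
        rw [hc, map_mul]
        have hX : ev E (X : ℤ[X]) = E := by simp [ev]
        rw [hX]
        exact Dvd.dvd.mul_right hXE _
      · rw [X_dvd_iff, hG, tpol_coeff, if_pos hp.pos, gc]
    exact X_dvd_iff.1 this
  · have := h6 d (by omega)
    rw [coeff_derivative] at this
    rcases mul_eq_zero.1 this with h | h
    · exact h
    · exfalso
      have h' : ((d + 1 : ℕ) : LaurentSeries F) = 0 := by exact_mod_cast h
      rw [CharP.cast_eq_zero_iff _ p] at h'
      exact absurd (Nat.le_of_dvd (by omega) h') (by omega)

/-- Polynomials whose `i`-th coefficient has order at least `-i`. -/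
def WW (F : Type*) [Field F] : Subring (LaurentSeries F)[X] where
  carrier := {f | ∀ i : ℕ, Ge (f.coeff i) (-i)}
  mul_mem' := fun {f g} h1 h2 i => by
    rw [coeff_mul]
    refine Ge.sum fun ab hab => ?_
    have := Finset.HasAntidiagonal.mem_antidiagonal.1 hab
    refine ((h1 ab.1).mul (h2 ab.2)).mono ?_
    rw [← this]; push_cast; linarith
  one_mem' := fun i => by
    rw [coeff_one]
    split_ifs with h
    · subst h; simpa using Ge.one
    · exact Ge.zero _
  add_mem' := fun {f g} h1 h2 i => by
    rw [coeff_add]; exact (h1 i).add (h2 i)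
  zero_mem' := fun i => by simpa using Ge.zero _
  neg_mem' := fun {f} h1 i => by
    rw [coeff_neg]; exact (h1 i).neg

lemma ev_mem_WW {E : (LaurentSeries F)[X]} (hE : E ∈ WW F) (c : ℤ[X]) : ev E c ∈ WW F := by
  have := hom_ev (WW F).subtype ⟨E, hE⟩ c
  rw [Subring.subtype_apply] at this
  have h2 : (WW F).subtype ⟨E, hE⟩ = E := rfl
  rw [h2] at this
  rw [← this]
  exact Subtype.property _

lemma tpol_mem_WW {a : ℕ → LaurentSeries F} (h : ∀ i, Ge (a i) (-i)) : tpol p a ∈ WW F := by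
  intro i
  rw [tpol_coeff]
  split_ifs
  · exact h i
  · exact Ge.zero _

lemma eval_ge {F' : Type*} [Field F'] (v : LaurentSeries F →+* LaurentSeries F')
    (hv : ∀ x N, Ge x N → Ge (v x) N) (f : (LaurentSeries F)[X]) (hf : f ∈ WW F)
    (hd : X ^ p ∣ f) (h : LaurentSeries F') (r : ℕ) (hh : Ge h (1 + r)) :
    Ge (eval₂ v h f) (p * r) := by
  rw [eval₂_eq_sum_range]
  refine Ge.sum fun i _ => ?_
  by_cases hi : i < p
  · rw [X_pow_dvd_iff.1 hd i hi]; simpa using Ge.zero _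
  · refine ((hv _ _ (hf i)).mul (hh.pow i)).mono ?_
    have : (p : ℤ) * r ≤ i * r := by
      have : (p : ℤ) ≤ i := by exact_mod_cast not_lt.1 hi
      gcongr
    linarith

end cwsec

/-! ### Witt vectors -/

section witt

open WittVector

variable {p : ℕ} [hp : Fact p.Prime]

lemma coeff_teich_add_V_zero {R : Type*} [CommRing R] (a : R) (y : WittVector p R) :
    (teichmuller p a + verschiebung y).coeff 0 = a := by
  rw [add_coeff_zero, teichmuller_coeff_zero, verschiebung_coeff_zero, add_zero]

lemma coeff_teich_add_V_succ {R : Type*} [CommRing R] (a : R) (y : WittVector p R) (n : ℕ) :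
    (teichmuller p a + verschiebung y).coeff (n + 1) = y.coeff n := by
  rw [coeff_add_of_disjoint]
  · rw [teichmuller_coeff_pos _ _ _ (by omega), verschiebung_coeff_succ, zero_add]
  · intro i
    rcases i with _ | i
    · right; exact verschiebung_coeff_zero _
    · left; exact teichmuller_coeff_pos _ _ _ (by omega)

lemma eq_teich_add_V {R : Type*} [CommRing R] (A : WittVector p R) :
    A = teichmuller p (A.coeff 0) + verschiebung (A.shift 1) := by
  ext n
  rcases n with _ | n
  · rw [coeff_teich_add_V_zero]
  · rw [coeff_teich_add_V_succ, shift_coeff, add_comm]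

lemma teich_mul_coeff {R : Type*} [CommRing R] [CharP R p] (n : ℕ) : ∀ (c : R) (A : WittVector p R),
    (teichmuller p c * A).coeff n = c ^ p ^ n * A.coeff n := by
  induction n with
  | zero => intro c A; rw [mul_coeff_zero, teichmuller_coeff_zero]; simp
  | succ n ih =>
    intro c A
    have h1 : teichmuller p c * A = teichmuller p (c * A.coeff 0) +
        verschiebung (teichmuller p (c ^ p) * A.shift 1) := by
      conv_lhs => rw [eq_teich_add_V A]
      rw [mul_add, ← map_mul]
      congr 1
      have h2 : teichmuller p (c ^ p) = WittVector.frobenius (teichmuller p c) := by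
        rw [frobenius_eq_map_frobenius, map_teichmuller]; rfl
      rw [h2, mul_comm (WittVector.frobenius _), verschiebung_mul_frobenius, mul_comm]
    rw [h1, coeff_teich_add_V_succ, ih, shift_coeff, ← pow_mul, ← pow_succ', add_comm 1 n]

lemma sub_V_coeff {R : Type*} [CommRing R] (s : ℕ) : ∀ (W Z : WittVector p R),
    (∀ i < s, (W - verschiebung^[s] Z).coeff i = W.coeff i) ∧
      (W - verschiebung^[s] Z).coeff s = W.coeff s - Z.coeff 0 := by
  induction s with
  | zero =>
    intro W Z
    refine ⟨fun i hi => absurd hi (by omega), ?_⟩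
    exact map_sub (constantCoeff (p := p) (R := R)) W Z
  | succ s ih =>
    intro W Z
    have h : W - verschiebung^[s + 1] Z = teichmuller p (W.coeff 0) +
        verschiebung (W.shift 1 - verschiebung^[s] Z) := by
      rw [Function.iterate_succ_apply', map_sub, ← add_sub_assoc, ← eq_teich_add_V]
    rw [h]
    obtain ⟨h1, h2⟩ := ih (W.shift 1) Z
    constructor
    · intro i hi
      rcases i with _ | i
      · rw [coeff_teich_add_V_zero]
      · rw [coeff_teich_add_V_succ, h1 i (by omega), shift_coeff, add_comm]
    · rw [coeff_teich_add_V_succ, h2, shift_coeff, add_comm 1 s]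

/-- The filtration on (untruncated) Witt vectors. -/
def Fil (m : ℕ) (N : ℤ) (A : WittVector p (LaurentSeries F)) : Prop :=
  ∀ i ≤ m, A.coeff i = 0 ∨ -N ≤ (p : ℤ) ^ (m - i) * (A.coeff i).order

lemma int_sub {m : ℕ} {A B : WittVector p (LaurentSeries F)} (hA : ∀ i ≤ m, Ge (A.coeff i) 0)
    (hB : ∀ i ≤ m, Ge (B.coeff i) 0) : ∀ i ≤ m, Ge ((A - B).coeff i) 0 := by
  intro i hi
  have hinit : ∀ A : WittVector p (LaurentSeries F), (∀ i ≤ m, Ge (A.coeff i) 0) →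
      ∃ A' : WittVector p (OO F), map (OO F).subtype A' = WittVector.init (m + 1) A := by
    intro A hA
    refine ⟨WittVector.mk p fun i => if h : i ≤ m then ⟨A.coeff i, mem_OO.2 (hA i h)⟩ else 0, ?_⟩
    refine WittVector.ext fun i => ?_
    rw [map_coeff, WittVector.init, WittVector.select, coeff_mk, coeff_mk]
    by_cases h : i ≤ m
    · rw [dif_pos h, if_pos (by omega)]; rfl
    · rw [dif_neg h, if_neg (by omega)]; rfl
  obtain ⟨A', hA'⟩ := hinit A hA
  obtain ⟨B', hB'⟩ := hinit B hB
  have hc : ∀ C : WittVector p (LaurentSeries F), (WittVector.init (m + 1) C).coeff i = C.coeff i := by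
    intro C
    rw [WittVector.init, WittVector.select, coeff_mk, if_pos (by omega)]
  rw [← hc, init_sub, hc, ← hA', ← hB', ← map_sub, map_coeff]
  exact mem_OO.1 ((A' - B').coeff i).2

lemma fil_iff [CharP F p] (m : ℕ) (N : ℤ) (A : WittVector p (LaurentSeries F)) :
    Fil m N A ↔ ∀ i ≤ m, Ge ((teichmuller p (tt ^ N) *
      map (iterateFrobenius (LaurentSeries F) p m) A).coeff i) 0 := by
  refine forall_congr' fun i => forall_congr' fun hi => ?_
  have hpp : p.Prime := hp.out
  rw [teich_mul_coeff, map_coeff, iterateFrobenius_def, ge_iff]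
  have ht : ((tt : LaurentSeries F) ^ N) ^ p ^ i ≠ 0 := pow_ne_zero _ (zpow_ne_zero _ tt_ne)
  by_cases h0 : A.coeff i = 0
  · simp [h0, hpp.ne_zero]
  · have h1 : A.coeff i ^ p ^ m ≠ 0 := pow_ne_zero _ h0
    rw [HahnSeries.order_mul ht h1, HahnSeries.order_pow, HahnSeries.order_pow, tt_zpow,
      HahnSeries.order_single one_ne_zero]
    simp only [h0, mul_eq_zero, pow_eq_zero_iff', HahnSeries.single_eq_zero_iff, one_ne_zero,
      false_and, or_self, false_or, nsmul_eq_mul, Nat.cast_pow]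
    have hm : (p : ℤ) ^ m = p ^ i * p ^ (m - i) := by rw [← pow_add]; congr 1; omega
    have hpos : (0 : ℤ) < p ^ i := pow_pos (by exact_mod_cast hpp.pos) _
    rw [hm, mul_assoc, ← mul_add, mul_nonneg_iff_of_pos_left hpos]
    constructor <;> intro h <;> linarith

lemma Fil.sub [CharP F p] {m : ℕ} {N : ℤ} {A B : WittVector p (LaurentSeries F)}
    (hA : Fil m N A) (hB : Fil m N B) : Fil m N (A - B) := by
  rw [fil_iff] at *
  rw [map_sub, mul_sub]
  exact int_sub hA hB

lemma Fil.add [CharP F p] {m : ℕ} {N : ℤ} {A B : WittVector p (LaurentSeries F)}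
    (hA : Fil m N A) (hB : Fil m N B) : Fil m N (A + B) := by
  have h0 : Fil m N (0 : WittVector p (LaurentSeries F)) := fun i _ => Or.inl (zero_coeff p _ i)
  have := hA.sub (h0.sub hB)
  simpa using this

lemma Fil.V {m : ℕ} {N : ℤ} {A : WittVector p (LaurentSeries F)} (hA : Fil m N A) :
    Fil (m + 1) N (verschiebung A) := by
  intro i hi
  rcases i with _ | i
  · left; exact verschiebung_coeff_zero _
  · rw [verschiebung_coeff_succ, Nat.add_sub_add_right]
    exact hA i (by omega)

lemma fil_of_ge {c : LaurentSeries F} {M N : ℤ} {e : ℕ} (hc : Ge c M) (h : -N ≤ (p : ℤ) ^ e * M) :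
    c = 0 ∨ -N ≤ (p : ℤ) ^ e * c.order := by
  rcases (ge_iff _ _).1 hc with h0 | h0
  · exact Or.inl h0
  · right
    have : (0 : ℤ) ≤ p ^ e := by positivity
    nlinarith

lemma iter_const_mul (y w : LaurentSeries F) (hy : lsDeriv y = 0) (i : ℕ) :
    lsDeriv^[i] (y * w) = y * lsDeriv^[i] w := by
  induction i generalizing w with
  | zero => rfl
  | succ i ih => rw [Function.iterate_succ_apply, Function.iterate_succ_apply, lsDeriv_mul, hy,
      zero_mul, zero_add, ih]

lemma lsDeriv_ppow [CharP F p] (x : LaurentSeries F) (s : ℕ) (hs : 1 ≤ s) :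
    lsDeriv (x ^ p ^ s) = 0 := by
  have hpos : 0 < p ^ s := pow_pos hp.out.pos _
  obtain ⟨n, hn⟩ := Nat.exists_eq_succ_of_ne_zero hpos.ne'
  have h0 : ((n + 1 : ℕ) : LaurentSeries F) = 0 := by
    rw [CharP.cast_eq_zero_iff _ p, ← Nat.succ_eq_add_one, ← hn]
    exact dvd_pow_self _ (by omega)
  rw [hn, Nat.succ_eq_add_one, lsDeriv_pow, h0]
  simp

end witt

section main

open WittVector Polynomial

variable {k : Type*} [Field k] {p : ℕ} [hp : Fact p.Prime] [CharP k p]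

/-- The correction term as a function of `α`. -/
def zz (p r : ℕ) (v : LaurentSeries k →+* LaurentSeries (RatFunc k)) (b : LaurentSeries k) :
    LaurentSeries (RatFunc k) :=
  ∑ i ∈ Finset.Icc 1 (p - 1),
          v (tt ^ i * lsDeriv^[i - 1] b / (Nat.factorial i : LaurentSeries k)) *
            ((tt : LaurentSeries (RatFunc k)) ^ r * θθ k) ^ i

lemma v_tt {v : LaurentSeries k →+* LaurentSeries (RatFunc k)}
    (hv : ∀ (x : LaurentSeries k) (j : ℤ),
      (v x).coeff j = algebraMap k (RatFunc k) (x.coeff j)) : v tt = tt := by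
  ext i
  rw [hv, tt, tt]
  simp only [HahnSeries.coeff_single]
  split_ifs <;> simp

lemma zz_add (r : ℕ) (v : LaurentSeries k →+* LaurentSeries (RatFunc k)) (b c : LaurentSeries k) :
    zz p r v (b + c) = zz p r v b + zz p r v c := by
  simp only [zz, iter_add, mul_add, add_div, map_add, add_mul, Finset.sum_add_distrib]

lemma zz_zero (r : ℕ) (v : LaurentSeries k →+* LaurentSeries (RatFunc k)) :
    zz p r v 0 = 0 := by
  simp [zz, iter_zero]

/-- The correction term, rewritten as a sum over `range`. -/
lemma zz_eq {v : LaurentSeries k →+* LaurentSeries (RatFunc k)}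
    (hv : ∀ (x : LaurentSeries k) (j : ℤ),
      (v x).coeff j = algebraMap k (RatFunc k) (x.coeff j)) (r : ℕ) (b : LaurentSeries k) :
    zz p r v b = ∑ i ∈ Finset.range p, v (gc b i) * (tt * (tt ^ r * θθ k)) ^ i := by
  obtain ⟨q, hq⟩ := Nat.exists_eq_succ_of_ne_zero hp.out.ne_zero
  rw [hq, Finset.sum_range_succ', zz]
  simp only [gc, map_zero, zero_mul, add_zero]
  rw [Nat.succ_sub_one]
  refine Finset.sum_nbij' (fun i => i - 1) (fun i => i + 1) ?_ ?_ ?_ ?_ ?_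
  · intro i hi
    rw [Finset.mem_Icc] at hi
    rw [Finset.mem_range]; omega
  · intro i hi
    rw [Finset.mem_range] at hi
    rw [Finset.mem_Icc]; omega
  · intro i hi
    rw [Finset.mem_Icc] at hi
    omega
  · intro i hi
    rfl
  · intro i hi
    rw [Finset.mem_Icc] at hi
    obtain ⟨j, rfl⟩ := Nat.exists_eq_add_of_le' hi.1
    simp only [Nat.add_sub_cancel]
    rw [mul_pow tt, mul_div_assoc, map_mul, map_pow, v_tt hv]
    ring

end main
section main2

open WittVector Polynomial

variable {k : Type*} [Field k] {p : ℕ} [hp : Fact p.Prime] [CharP k p]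

instance charP_ratFunc : CharP (RatFunc k) p :=
  charP_of_injective_ringHom (f := algebraMap k (RatFunc k))
    (algebraMap k (RatFunc k)).injective p

lemma eval_tpol {F' : Type*} [Field F'] (v : LaurentSeries k →+* LaurentSeries F')
    (h : LaurentSeries F') (a : ℕ → LaurentSeries k) :
    eval₂ v h (tpol p a) = ∑ i ∈ Finset.range p, v (a i) * h ^ i := by
  simp [tpol, eval₂_finsetSum]

lemma ge_gc (w : LaurentSeries k) (hw : Ge w (-1)) (i : ℕ) : Ge (gc w i) (-i) := by
  rcases i with _ | i
  · exact Ge.zero _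
  · rw [gc, div_eq_mul_inv]
    refine ((hw.iter i).mul (Ge.natCast_inv _)).mono ?_
    push_cast; linarith

/-- Estimates for the multiplicative defect. -/
lemma core (r : ℕ) (u v : LaurentSeries k →+* LaurentSeries (RatFunc k))
    (hv : ∀ (x : LaurentSeries k) (j : ℤ),
      (v x).coeff j = algebraMap k (RatFunc k) (x.coeff j))
    (hT : ∀ (x : LaurentSeries k) (N : ℤ), Ge x N →
      Ge (u x - ∑ i ∈ Finset.range p, v (tc x i) * (tt * (tt ^ r * θθ k)) ^ i) (N + p * r))
    (x : LaurentSeries k) (hx : x ≠ 0) :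
    Ge (u x / v x - 1) r ∧ ∀ s, 1 ≤ s →
      Ge (ev (u x / v x - 1) (cw p s) -
        ∑ i ∈ Finset.range p, v (gc (lsDeriv x / x) i) * (tt * (tt ^ r * θθ k)) ^ i) (p * r) := by
  have hp1 : 1 ≤ p := hp.out.one_le
  set h : LaurentSeries (RatFunc k) := tt * (tt ^ r * θθ k) with hh
  have hge : Ge h (1 + r) := ge_tt.mul (ge_s r)
  have hvx : v x ≠ 0 := (map_ne_zero v).2 hx
  set E : (LaurentSeries k)[X] := C x⁻¹ * tpol p (tc x) - 1 with hE
  have hxx : Ge (v x)⁻¹ (-x.order) := by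
    rw [← map_inv₀]; exact ge_v hv (ge_inv hx)
  have hEe : eval₂ v h E = (v x)⁻¹ * (∑ i ∈ Finset.range p, v (tc x i) * h ^ i) - 1 := by
    rw [hE, eval₂_sub, eval₂_mul, eval₂_C, eval₂_one, eval_tpol, map_inv₀]
  have hd : Ge ((u x / v x - 1) - eval₂ v h E) (p * r) := by
    have : (u x / v x - 1) - eval₂ v h E =
        (v x)⁻¹ * (u x - ∑ i ∈ Finset.range p, v (tc x i) * h ^ i) := by
      rw [hEe]; ring
    rw [this]
    refine (hxx.mul (hT x x.order (ge_order x))).mono ?_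
    linarith
  have hEr : Ge (eval₂ v h E) r := by
    obtain ⟨q, hq⟩ := Nat.exists_eq_succ_of_ne_zero hp.out.ne_zero
    have : eval₂ v h E = (v x)⁻¹ * ∑ i ∈ Finset.range q, v (tc x (i + 1)) * h ^ (i + 1) := by
      rw [hEe, hq, Finset.sum_range_succ', mul_add]
      have h0 : tc x 0 = x := by simp [tc]
      rw [h0, pow_zero, mul_one, inv_mul_cancel₀ hvx]
      ring
    rw [this]
    have h2 : Ge (∑ i ∈ Finset.range q, v (tc x (i + 1)) * h ^ (i + 1)) (x.order + r) := by
      refine Ge.sum fun i _ => ?_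
      refine ((ge_v hv ((ge_order x).tc (i + 1))).mul (hge.pow (i + 1))).mono ?_
      push_cast
      nlinarith [mul_nonneg (Int.natCast_nonneg i) (Int.natCast_nonneg r)]
    refine (hxx.mul h2).mono ?_
    linarith
  have hpr : (r : ℤ) ≤ p * r := by
    have : (1 : ℤ) ≤ p := by exact_mod_cast hp1
    nlinarith [Int.natCast_nonneg r]
  have hr0 : (0 : ℤ) ≤ r := Int.natCast_nonneg r
  have hε : Ge (u x / v x - 1) r := by
    have := (hd.mono hpr).add hEr
    rwa [sub_add_cancel] at this
  refine ⟨hε, fun s hs => ?_⟩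
  have hw : Ge (lsDeriv x / x) (-1) := by
    rw [div_eq_mul_inv]
    refine ((ge_order x).lsDeriv.mul (ge_inv hx)).mono ?_
    linarith
  have hEW : E ∈ WW k := by
    refine sub_mem ?_ (one_mem _)
    intro i
    rw [coeff_C_mul, tpol_coeff]
    split_ifs
    · refine ((ge_inv hx).mul ((ge_order x).tc i)).mono ?_
      linarith
    · rw [mul_zero]; exact Ge.zero _
  have h3 := eval_ge p v (fun x N hx => ge_v hv hx) _
    (sub_mem (ev_mem_WW hEW (cw p s)) (tpol_mem_WW p (ge_gc _ hw))) (log_congr p x hx s hs) h r hge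
  have h4 := ge_ev_sub (cw p s) (hε.mono hr0) (hEr.mono hr0) hd
  have h5 := hom_ev (eval₂RingHom v h) E (cw p s)
  rw [coe_eval₂RingHom] at h5
  rw [eval₂_sub, h5, eval_tpol] at h3
  have := h4.add h3
  rwa [sub_add_sub_cancel] at this

lemma teich_fil (r : ℕ) (u v : LaurentSeries k →+* LaurentSeries (RatFunc k))
    (hv : ∀ (x : LaurentSeries k) (j : ℤ),
      (v x).coeff j = algebraMap k (RatFunc k) (x.coeff j))
    (hT : ∀ (x : LaurentSeries k) (N : ℤ), Ge x N →
      Ge (u x - ∑ i ∈ Finset.range p, v (tc x i) * (tt * (tt ^ r * θθ k)) ^ i) (N + p * r))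
    (x : LaurentSeries k) (s : ℕ) (hs : 1 ≤ s) (n : ℤ) (hx : x = 0 ∨ -n ≤ (p : ℤ) ^ s * x.order)
    (Z : WittVector p (LaurentSeries (RatFunc k)))
    (hZ : Z.coeff 0 = zz p r v (x ^ (p ^ s - 1) * lsDeriv x)) :
    Fil s (n - p * r) (teichmuller p (u x) - teichmuller p (v x) - verschiebung^[s] Z) := by
  have hpp : p.Prime := hp.out
  obtain ⟨hlt, heq⟩ := sub_V_coeff s (teichmuller p (u x) - teichmuller p (v x)) Z
  by_cases hx0 : x = 0
  · subst hx0
    have hl0 : lsDeriv (0 : LaurentSeries k) = 0 := iter_zero 1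
    rw [hl0, mul_zero, zz_zero] at hZ
    intro i hi
    left
    rcases hi.lt_or_eq with h | h
    · rw [hlt i h, map_zero u, map_zero v, sub_self, zero_coeff]
    · rw [h, heq, map_zero u, map_zero v, sub_self, zero_coeff, hZ, sub_zero]
  replace hx := hx.resolve_left hx0
  have hvx : v x ≠ 0 := (map_ne_zero v).2 hx0
  obtain ⟨c1, c2⟩ := core r u v hv hT x hx0
  set ε := u x / v x - 1 with hε
  have hW : teichmuller p (u x) - teichmuller p (v x) =
      teichmuller p (v x) * (teichmuller p (1 + ε) - 1) := by
    rw [mul_sub, ← map_mul, mul_one, hε, add_sub_cancel, mul_div_cancel₀ _ hvx]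
  have hc : ∀ i, (teichmuller p (u x) - teichmuller p (v x)).coeff i =
      v x ^ p ^ i * ev ε (cw p i) := by
    intro i
    rw [hW, teich_mul_coeff, ev_cw]
  have hy : ∀ i : ℕ, Ge (v x ^ p ^ i) (p ^ i * x.order) := by
    intro i
    have := (ge_v hv (ge_order x)).pow (p ^ i)
    push_cast at this
    exact this
  have hr0 : (0 : ℤ) ≤ r := Int.natCast_nonneg r
  have hp1 : (1 : ℤ) ≤ p := by exact_mod_cast hpp.one_le
  intro i hi
  rcases hi.lt_or_eq with h | h
  · rw [hlt i h, hc]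
    have h0 : ev (0 : LaurentSeries (RatFunc k)) (cw p i) = 0 := by
      rw [ev_cw, add_zero, map_one, sub_self, zero_coeff]
    have h1 : Ge (ev ε (cw p i)) r := by
      have := ge_ev_sub (cw p i) (c1.mono hr0) (Ge.zero 0) (by rwa [sub_zero])
      rwa [h0, sub_zero] at this
    refine fil_of_ge ((hy i).mul h1) ?_
    have e1 : (p : ℤ) ^ s = p ^ (s - i) * p ^ i := by rw [← pow_add]; congr 1; omega
    have e2 : (p : ℤ) ≤ p ^ (s - i) := le_self_pow₀ hp1 (by omega)
    rw [mul_add, ← mul_assoc, ← e1]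
    have e3 : (p : ℤ) * r ≤ p ^ (s - i) * r := mul_le_mul_of_nonneg_right e2 hr0
    linarith
  · subst h
    have hz : zz p r v (x ^ (p ^ i - 1) * lsDeriv x) = v x ^ p ^ i *
        ∑ j ∈ Finset.range p, v (gc (lsDeriv x / x) j) * (tt * (tt ^ r * θθ k)) ^ j := by
      have e1 : x ^ (p ^ i - 1) * lsDeriv x = x ^ p ^ i * (lsDeriv x / x) := by
        have : x ^ p ^ i = x ^ (p ^ i - 1) * x := by
          rw [← pow_succ, Nat.sub_add_cancel (Nat.one_le_pow _ _ hpp.pos)]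
        rw [this]; field_simp
      rw [zz_eq hv, e1, Finset.mul_sum]
      refine Finset.sum_congr rfl fun j _ => ?_
      have e2 : gc (x ^ p ^ i * (lsDeriv x / x)) j = x ^ p ^ i * gc (lsDeriv x / x) j := by
        rcases j with _ | j
        · simp [gc]
        · rw [gc, gc, iter_const_mul _ _ (lsDeriv_ppow x i hs), mul_div_assoc]
      rw [e2, map_mul, map_pow, mul_assoc]
    rw [heq, hc, hZ, hz, ← mul_sub]
    refine fil_of_ge ((hy i).mul (c2 i hs)) ?_
    rw [Nat.sub_self, pow_zero, one_mul]
    linarith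

lemma V_iter_sub {R : Type*} [CommRing R] (m : ℕ) (A B : WittVector p R) :
    verschiebung^[m] (A - B) = verschiebung^[m] A - verschiebung^[m] B := by
  induction m generalizing A B with
  | zero => rfl
  | succ m ih => rw [Function.iterate_succ_apply, map_sub, ih]; rfl

lemma main_fil (r : ℕ) (u v : LaurentSeries k →+* LaurentSeries (RatFunc k))
    (hv : ∀ (x : LaurentSeries k) (j : ℤ),
      (v x).coeff j = algebraMap k (RatFunc k) (x.coeff j))
    (hT : ∀ (x : LaurentSeries k) (N : ℤ), Ge x N →
      Ge (u x - ∑ i ∈ Finset.range p, v (tc x i) * (tt * (tt ^ r * θθ k)) ^ i) (N + p * r))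
    (n : ℤ) (m : ℕ) : ∀ (A : WittVector p (LaurentSeries k)), Fil m n A →
    ∀ Z : WittVector p (LaurentSeries (RatFunc k)),
    Z.coeff 0 = zz p r v (∑ i ∈ Finset.range (m + 1),
      A.coeff i ^ (p ^ (m - i) - 1) * lsDeriv (A.coeff i)) →
    Fil m (n - p * r) (map u A - map v A - verschiebung^[m] Z) := by
  have hpp : p.Prime := hp.out
  induction m with
  | zero =>
    intro A hA Z hZ i hi
    obtain rfl : i = 0 := by omega
    rw [(sub_V_coeff 0 _ Z).2, hZ]
    have h1 : (map u A - map v A).coeff 0 = u (A.coeff 0) - v (A.coeff 0) :=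
      map_sub (constantCoeff (p := p) (R := LaurentSeries (RatFunc k))) _ _
    rw [h1, zz_eq hv]
    have hA0 := hA 0 le_rfl
    simp only [Nat.sub_zero, pow_zero, one_mul] at hA0
    have h2 := hT _ _ ((ge_iff _ _).2 hA0)
    have h3 : ∑ i ∈ Finset.range p, v (tc (A.coeff 0) i) * (tt * (tt ^ r * θθ k)) ^ i =
        v (A.coeff 0) + ∑ i ∈ Finset.range p, v (gc (lsDeriv (A.coeff 0)) i) *
          (tt * (tt ^ r * θθ k)) ^ i := by
      generalize A.coeff 0 = y
      obtain ⟨q, hq⟩ := Nat.exists_eq_succ_of_ne_zero hpp.ne_zero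
      rw [hq, Finset.sum_range_succ', Finset.sum_range_succ']
      simp only [gc, tc, Function.iterate_succ_apply, Function.iterate_zero, id, map_zero]
      simp [add_comm]
    rw [h3, ← sub_sub] at h2
    have := fil_of_ge (p := p) (e := 0 - 0) (N := n - p * r) h2 (by simp)
    simpa using this
  | succ m ih =>
    intro A hA Z hZ
    set A1 := A.shift 1 with hA1
    have hc : ∀ i, A1.coeff i = A.coeff (i + 1) := fun i => by rw [hA1, shift_coeff, add_comm]
    set b := ∑ i ∈ Finset.range (m + 1), A1.coeff i ^ (p ^ (m - i) - 1) * lsDeriv (A1.coeff i)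
    set Z1 := teichmuller p (zz p r v b)
    have hF1 : Fil m n A1 := by
      intro i hi
      have := hA (i + 1) (by omega)
      rwa [Nat.add_sub_add_right, ← hc] at this
    have i1 := ih A1 hF1 Z1 (teichmuller_coeff_zero _ _)
    have hZ0 : (Z - Z1).coeff 0 = zz p r v (A.coeff 0 ^ (p ^ (m + 1) - 1) * lsDeriv (A.coeff 0)) := by
      have h1 : (Z - Z1).coeff 0 = Z.coeff 0 - Z1.coeff 0 :=
        map_sub (constantCoeff (p := p) (R := LaurentSeries (RatFunc k))) _ _
      rw [h1, hZ, teichmuller_coeff_zero, Finset.sum_range_succ', zz_add]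
      have h2 : ∑ i ∈ Finset.range (m + 1), A.coeff (i + 1) ^ (p ^ (m + 1 - (i + 1)) - 1) *
          lsDeriv (A.coeff (i + 1)) = b := by
        refine Finset.sum_congr rfl fun i _ => ?_
        rw [hc, Nat.add_sub_add_right]
      rw [h2, Nat.sub_zero, add_sub_cancel_left]
    have i0 := teich_fil r u v hv hT (A.coeff 0) (m + 1) (by omega) n
      (by simpa using hA 0 (by omega)) (Z - Z1) hZ0
    have := i0.add i1.V
    convert this using 1
    have hdec : ∀ g : LaurentSeries k →+* LaurentSeries (RatFunc k),
        map g A = teichmuller p (g (A.coeff 0)) + verschiebung (map g A1) := by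
      intro g
      conv_lhs => rw [eq_teich_add_V A]
      rw [map_add, map_teichmuller, map_verschiebung]
    rw [hdec u, hdec v, V_iter_sub, map_sub, map_sub,
      Function.iterate_succ_apply' _ m Z1]
    abel

end main2

/-- For `a ∈ fil_n W_{m+1}(K)` with `α = α(a)`, the element
`W_{m+1}(u)(a) − W_{m+1}(v)(a) − V^m( Σ_{i=1}^{p−1} v(t^i·α^{(i−1)}/i!)·(t^r·θ)^i )`
of `W_{m+1}(L)` lies in `fil_{n−pr} W_{m+1}(L)`.
Here `v : K → L` is the coefficientwise inclusion and `u : K → L` is the unique continuous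
`k`-algebra homomorphism with `u(t) = t(1 + t^r·θ)`, both characterized by hypotheses. -/
theorem statement1 (p : ℕ) [Fact p.Prime] (hp2 : 2 < p)
    (k : Type*) [Field k] [PerfectField k] [CharP k p]
    (r : ℕ) (hr : 1 ≤ r)
    (u v : LaurentSeries k →+* LaurentSeries (RatFunc k))
    (hv : ∀ (x : LaurentSeries k) (j : ℤ),
      (v x).coeff j = algebraMap k (RatFunc k) (x.coeff j))
    (hu_alg : ∀ c : k,
      u (HahnSeries.single 0 c) = HahnSeries.single 0 (algebraMap k (RatFunc k) c))
    (hu_t : u tt = tt * (1 + tt ^ r * θθ k))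
    (hu_cont : ∀ N : ℤ, ∃ M : ℤ, ∀ x : LaurentSeries k, ordGe x M → ordGe (u x) N)
    (m : ℕ) (n : ℤ)
    (a : TruncatedWittVector p (m + 1) (LaurentSeries k))
    (ha : inFil p n a) :
    inFil p (n - (p : ℤ) * (r : ℤ))
      (mapTW p u a - mapTW p v a -
        Vm p (∑ i ∈ Finset.Icc 1 (p - 1),
          v (tt ^ i * lsDeriv^[i - 1] (alphaW p a) / (Nat.factorial i : LaurentSeries k)) *
            ((tt : LaurentSeries (RatFunc k)) ^ r * θθ k) ^ i)) := by
  have hT := taylor p r hr u v hv hu_alg hu_t hu_cont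
  set A : WittVector p (LaurentSeries k) := a.out with hA
  have hcoe : ∀ i : Fin (m + 1), A.coeff i = a.coeff i := fun i => TruncatedWittVector.coeff_out a i
  have hFA : Fil m n A := by
    intro i hi
    have := ha ⟨i, by omega⟩
    rw [← hcoe] at this
    exact this
  set z := zz p r v (alphaW p a) with hz
  have hal : alphaW p a = ∑ i ∈ Finset.range (m + 1),
      A.coeff i ^ (p ^ (m - i) - 1) * lsDeriv (A.coeff i) := by
    rw [alphaW, Finset.sum_range]
    refine Finset.sum_congr rfl fun i _ => ?_
    rw [hcoe]
  have key := main_fil r u v hv hT n m A hFA (WittVector.teichmuller p z)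
    (by rw [WittVector.teichmuller_coeff_zero, hz, hal])
  have h1 : ∀ g : LaurentSeries k →+* LaurentSeries (RatFunc k),
      mapTW p g a = WittVector.truncate (m + 1) (WittVector.map g A) := by
    intro g
    refine TruncatedWittVector.ext fun i => ?_
    rw [WittVector.coeff_truncate, WittVector.map_coeff, hcoe, mapTW, TruncatedWittVector.coeff_mk]
  have h2 : Vm p (m := m) z =
      WittVector.truncate (m + 1) (WittVector.verschiebung^[m] (WittVector.teichmuller p z)) := by
    refine TruncatedWittVector.ext fun i => ?_
    rw [WittVector.coeff_truncate, Vm, TruncatedWittVector.coeff_mk]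
    split_ifs with hi
    · have := WittVector.iterate_verschiebung_coeff (WittVector.teichmuller p z) m 0
      rw [zero_add] at this
      rw [hi, this, WittVector.teichmuller_coeff_zero]
    · rw [WittVector.iterate_verschiebung_coeff_eq_zero]
      have := i.2
      omega
  change inFil p (n - (p : ℤ) * (r : ℤ)) (mapTW p u a - mapTW p v a - Vm p z)
  rw [h1, h1, h2, ← map_sub, ← map_sub]
  intro i
  rw [WittVector.coeff_truncate]
  exact key i (by have := i.2; omega)

end LFT
end
end

section
/- For every n ≥ 0, the polynomial Q_n has integer coefficients, i.e. Q_n ∈ ℤ[X_0,…,X_n,Y_0,…,Y_n], and Q_n lies in the ideal of ℤ[X_0,…,X_n,Y_0,…,Y_n] generated by Y_0,…,Y_n. -/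
noncomputable section

namespace QPoly

open MvPolynomial

/-- The variable `X_i`. -/
abbrev Xv (i : ℕ) : MvPolynomial (ℕ ⊕ ℕ) ℚ := X (Sum.inl i)

/-- The variable `Y_i`. -/
abbrev Yv (i : ℕ) : MvPolynomial (ℕ ⊕ ℕ) ℚ := X (Sum.inr i)

/-- `IsQFamily p Q` says that the family `Q` satisfies the inductive identity
`Σ_{i=0}^n p^i·(X_i·(1+Y_i))^{p^{n−i}} = Σ_{i=0}^n p^i·X_i^{p^{n−i}} + Σ_{i=0}^n p^i·Q_i^{p^{n−i}}`
for all `n ≥ 0`; since `p` is invertible in `ℚ`, this determines `Q` uniquely by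
recursion on `n`. -/
def IsQFamily (p : ℕ) (Q : ℕ → MvPolynomial (ℕ ⊕ ℕ) ℚ) : Prop :=
  ∀ n : ℕ,
    ∑ i ∈ Finset.range (n + 1),
        (p : MvPolynomial (ℕ ⊕ ℕ) ℚ) ^ i * (Xv i * (1 + Yv i)) ^ p ^ (n - i) =
      ∑ i ∈ Finset.range (n + 1), (p : MvPolynomial (ℕ ⊕ ℕ) ℚ) ^ i * Xv i ^ p ^ (n - i) +
        ∑ i ∈ Finset.range (n + 1), (p : MvPolynomial (ℕ ⊕ ℕ) ℚ) ^ i * Q i ^ p ^ (n - i)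

/-- Integral Witt-difference polynomials evaluated at `X_i (1 + Y_i)` and `X_i`. -/
def qInt (p : ℕ) [Fact p.Prime] (n : ℕ) : MvPolynomial (ℕ ⊕ ℕ) ℤ :=
  aeval (fun k : Fin 2 × ℕ => if k.1 = 0 then
    (X (Sum.inl k.2) * (1 + X (Sum.inr k.2)) : MvPolynomial (ℕ ⊕ ℕ) ℤ) else X (Sum.inl k.2))
    (wittStructureInt p (X 0 - X 1 : MvPolynomial (Fin 2) ℤ) n)

theorem qInt_identity (p : ℕ) [Fact p.Prime] (n : ℕ) :
    ∑ i ∈ Finset.range (n + 1),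
        (p : MvPolynomial (ℕ ⊕ ℕ) ℤ) ^ i *
          (X (Sum.inl i) * (1 + X (Sum.inr i))) ^ p ^ (n - i) =
      ∑ i ∈ Finset.range (n + 1),
        (p : MvPolynomial (ℕ ⊕ ℕ) ℤ) ^ i * X (Sum.inl i) ^ p ^ (n - i) +
        ∑ i ∈ Finset.range (n + 1),
          (p : MvPolynomial (ℕ ⊕ ℕ) ℤ) ^ i * qInt p i ^ p ^ (n - i) := by
  have h := wittStructureInt_prop p (X 0 - X 1 : MvPolynomial (Fin 2) ℤ) n
  have h2 := congrArg (aeval (fun k : Fin 2 × ℕ => if k.1 = 0 then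
    (X (Sum.inl k.2) * (1 + X (Sum.inr k.2)) : MvPolynomial (ℕ ⊕ ℕ) ℤ)
      else X (Sum.inl k.2))) h
  simp only [map_sub, bind₁_X_right, aeval_bind₁, aeval_rename, aeval_wittPolynomial,
    Function.comp_def, if_true, one_ne_zero, if_false] at h2
  have h3 : ∑ i ∈ Finset.range (n + 1),
      (p : MvPolynomial (ℕ ⊕ ℕ) ℤ) ^ i * qInt p i ^ p ^ (n - i) = _ := h2
  rw [h3]
  ring

theorem map_qInt (p : ℕ) [hp : Fact p.Prime]
    (Q : ℕ → MvPolynomial (ℕ ⊕ ℕ) ℚ) (hQ : IsQFamily p Q) (n : ℕ) :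
    MvPolynomial.map (Int.castRingHom ℚ) (qInt p n) = Q n := by
  induction n using Nat.strong_induction_on with
  | _ n ih =>
    have h1 := hQ n
    have h2 := congrArg (MvPolynomial.map (Int.castRingHom ℚ)) (qInt_identity p n)
    simp only [map_sum, map_add, map_mul, map_pow, map_natCast, map_X, map_one] at h2
    rw [h1] at h2
    have h3 := add_left_cancel h2
    rw [Finset.sum_range_succ, Finset.sum_range_succ] at h3
    rw [Finset.sum_congr rfl (fun i hi => by rw [← ih i (Finset.mem_range.1 hi)])] at h3
    have h4 := add_left_cancel h3
    have hp0 : (p : MvPolynomial (ℕ ⊕ ℕ) ℚ) ^ n ≠ 0 :=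
      pow_ne_zero _ (Nat.cast_ne_zero.2 hp.out.ne_zero)
    have h5 := mul_left_cancel₀ hp0 h4
    simpa using h5.symm

/-- The substitution killing `Y_i` for `i ≤ n`. -/
def killY (n : ℕ) : MvPolynomial (ℕ ⊕ ℕ) ℤ →ₐ[ℤ] MvPolynomial (ℕ ⊕ ℕ) ℤ :=
  aeval (Sum.elim (fun i => X (Sum.inl i)) (fun i => if i ≤ n then 0 else X (Sum.inr i)))

theorem killY_qInt (p : ℕ) [hp : Fact p.Prime] (n m : ℕ) (hm : m ≤ n) :
    killY n (qInt p m) = 0 := by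
  induction m using Nat.strong_induction_on with
  | _ m ih =>
    have h2 := congrArg (killY n) (qInt_identity p m)
    simp only [map_sum, map_add, map_mul, map_pow, map_natCast, map_one] at h2
    have hX : ∀ i, killY n (X (Sum.inl i)) = X (Sum.inl i) := fun i => by simp [killY]
    have hY : ∀ i ≤ n, killY n (X (Sum.inr i)) = 0 := fun i hi => by simp [killY, hi]
    rw [Finset.sum_congr rfl (fun i hi => by
      rw [hY i (by have := Finset.mem_range.1 hi; omega), add_zero, mul_one])] at h2
    have h3 := left_eq_add.1 h2
    rw [Finset.sum_range_succ, Finset.sum_eq_zero (fun i hi => by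
      have := Finset.mem_range.1 hi
      rw [ih i this (by omega), zero_pow (pow_ne_zero _ hp.out.ne_zero), mul_zero]),
      zero_add] at h3
    have hp0 : (p : MvPolynomial (ℕ ⊕ ℕ) ℤ) ^ m ≠ 0 :=
      pow_ne_zero _ (Nat.cast_ne_zero.2 hp.out.ne_zero)
    simpa using (mul_eq_zero.1 h3).resolve_left hp0

theorem mem_of_killY (n : ℕ) (q : MvPolynomial (ℕ ⊕ ℕ) ℤ) (h : killY n q = 0) :
    q ∈ Ideal.span {P : MvPolynomial (ℕ ⊕ ℕ) ℤ | ∃ i ≤ n, P = X (Sum.inr i)} := by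
  set J := Ideal.span {P : MvPolynomial (ℕ ⊕ ℕ) ℤ | ∃ i ≤ n, P = X (Sum.inr i)} with hJ
  have key : (Ideal.Quotient.mkₐ ℤ J).comp (killY n) = Ideal.Quotient.mkₐ ℤ J := by
    apply MvPolynomial.algHom_ext
    rintro (i | i)
    · simp [killY]
    · by_cases hi : i ≤ n
      · have : Ideal.Quotient.mk J (X (Sum.inr i)) = 0 :=
          Ideal.Quotient.eq_zero_iff_mem.2 (Ideal.subset_span ⟨i, hi, rfl⟩)
        simp [killY, hi, this]
      · simp [killY, hi]
  have := DFunLike.congr_fun key q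
  simp only [AlgHom.comp_apply, h, map_zero] at this
  exact Ideal.Quotient.eq_zero_iff_mem.1 this.symm

/-- For every `n ≥ 0`, the polynomial `Q_n` has integer coefficients,
i.e. `Q_n ∈ ℤ[X_0,…,X_n,Y_0,…,Y_n]`, and `Q_n` lies in the ideal of
`ℤ[X_0,…,X_n,Y_0,…,Y_n]` generated by `Y_0,…,Y_n`. -/
theorem statement2 (p : ℕ) (hp : p.Prime) (hp2 : 2 < p)
    (Q : ℕ → MvPolynomial (ℕ ⊕ ℕ) ℚ) (hQ : IsQFamily p Q) (n : ℕ) :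
    ∃ q : MvPolynomial (ℕ ⊕ ℕ) ℤ,
      MvPolynomial.map (Int.castRingHom ℚ) q = Q n ∧
      q ∈ Ideal.span {P : MvPolynomial (ℕ ⊕ ℕ) ℤ | ∃ i ≤ n, P = X (Sum.inr i)} := by
  haveI : Fact p.Prime := ⟨hp⟩
  exact ⟨qInt p n, map_qInt p Q hQ n, mem_of_killY n _ (killY_qInt p n n le_rfl)⟩

end QPoly
end
end

section
/- Assign to the variable X_i the weight p^i and to the variable Y_i the weight 0. Then for every n ≥ 0, the polynomial Q_n is isobaric (weighted homogeneous) of weight p^n. -/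
noncomputable section

namespace QPoly

open MvPolynomial

theorem term_homog (p : ℕ) (w : ℕ ⊕ ℕ → ℕ) (n i : ℕ) (hi : i ≤ n)
    (f : MvPolynomial (ℕ ⊕ ℕ) ℚ) (hf : f.IsWeightedHomogeneous w (p ^ i)) :
    ((p : MvPolynomial (ℕ ⊕ ℕ) ℚ) ^ i * f ^ p ^ (n - i)).IsWeightedHomogeneous w (p ^ n) := by
  have h := (hf.pow (p ^ (n - i))).C_mul ((p : ℚ) ^ i)
  have e : p ^ (n - i) • p ^ i = p ^ n := by
    rw [smul_eq_mul, ← pow_add, Nat.sub_add_cancel hi]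
  rw [e] at h
  simpa using h

/-- Assigning weight `p^i` to `X_i` and weight `0` to `Y_i`, the
polynomial `Q_n` is isobaric (weighted homogeneous) of weight `p^n`, for every `n ≥ 0`. -/
theorem statement3 (p : ℕ) (hp : p.Prime) (hp2 : 2 < p)
    (Q : ℕ → MvPolynomial (ℕ ⊕ ℕ) ℚ) (hQ : IsQFamily p Q) (n : ℕ) :
    (Q n).IsWeightedHomogeneous (Sum.elim (fun i => p ^ i) fun _ => 0) (p ^ n) := by
  induction n using Nat.strong_induction_on with
  | _ n ih =>
    set w : ℕ ⊕ ℕ → ℕ := Sum.elim (fun i => p ^ i) fun _ => 0 with hw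
    have hX : ∀ i, (Xv i).IsWeightedHomogeneous w (p ^ i) := fun i =>
      isWeightedHomogeneous_X ℚ w (Sum.inl i)
    have hY : ∀ i, (Yv i).IsWeightedHomogeneous w 0 := fun i =>
      isWeightedHomogeneous_X ℚ w (Sum.inr i)
    have hXY : ∀ i, (Xv i * (1 + Yv i)).IsWeightedHomogeneous w (p ^ i) := fun i => by
      simpa using (hX i).mul ((isWeightedHomogeneous_one ℚ w).add (hY i))
    have h1 := IsWeightedHomogeneous.sum (Finset.range (n + 1)) _ (p ^ n)
      fun i hi => term_homog p w n i (Nat.lt_succ_iff.mp (Finset.mem_range.mp hi)) _ (hXY i)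
    have h2 := IsWeightedHomogeneous.sum (Finset.range (n + 1)) _ (p ^ n)
      fun i hi => term_homog p w n i (Nat.lt_succ_iff.mp (Finset.mem_range.mp hi)) _ (hX i)
    have h3 := IsWeightedHomogeneous.sum (Finset.range n) _ (p ^ n)
      fun i hi => term_homog p w n i (Finset.mem_range.mp hi).le _
        (ih i (Finset.mem_range.mp hi))
    have key := hQ n
    rw [Finset.sum_range_succ (fun i => (p : MvPolynomial (ℕ ⊕ ℕ) ℚ) ^ i * Q i ^ p ^ (n - i)),
      Nat.sub_self, pow_zero, pow_one] at key
    have h4 := ((h1.sub h2).sub h3).C_mul (((p : ℚ) ^ n)⁻¹)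
    have hp0 : (p : ℚ) ^ n ≠ 0 := pow_ne_zero _ (Nat.cast_ne_zero.mpr hp.ne_zero)
    have hC : (C (((p : ℚ) ^ n)⁻¹) : MvPolynomial (ℕ ⊕ ℕ) ℚ) * (p : MvPolynomial (ℕ ⊕ ℕ) ℚ) ^ n
        = 1 := by
      have : (p : MvPolynomial (ℕ ⊕ ℕ) ℚ) ^ n = C ((p : ℚ) ^ n) := by simp
      rw [this, ← C_mul, inv_mul_cancel₀ hp0, C_1]
    rw [key] at h4
    refine Eq.mp (congrArg (fun f => IsWeightedHomogeneous w f (p ^ n)) ?_) h4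
    linear_combination (Q n) * hC

end QPoly
end
end

section
/- For every n ≥ 0, the element Q_n − ( Σ_{i=0}^{n−1} X_i^{p^{n−i}}·λ(Y_i) + X_n·Y_n ) of ℤ_(p)[X_0,…,X_n,Y_0,…,Y_n] lies in the ideal generated by p together with the p-th power of the ideal generated by Y_0,…,Y_n, i.e. in (p) + (Y_0,…,Y_n)^p. -/
noncomputable section

namespace QPoly

open MvPolynomial

/-- `q ∈ ℚ` is `p`-integral, i.e. lies in the localization `ℤ_(p) ⊆ ℚ`. -/
def PIntegral (p : ℕ) (q : ℚ) : Prop := q = 0 ∨ 0 ≤ padicValRat p q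

/-- A polynomial with `p`-integral coefficients, i.e. lying in `ℤ_(p)[X,Y] ⊆ ℚ[X,Y]`. -/
def PIntegralPoly (p : ℕ) (P : MvPolynomial (ℕ ⊕ ℕ) ℚ) : Prop :=
  ∀ d : (ℕ ⊕ ℕ) →₀ ℕ, PIntegral p (MvPolynomial.coeff d P)

lemma pint_iff (p : ℕ) [Fact p.Prime] (q : ℚ) : PIntegral p q ↔ padicNorm p q ≤ 1 := by
  unfold PIntegral
  by_cases h : q = 0
  · simp [h]
  · rw [padicNorm.eq_zpow_of_nonzero h]
    have hp1 : (1 : ℚ) < p := by exact_mod_cast (Fact.out : p.Prime).one_lt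
    rw [zpow_le_one_iff_right₀ hp1]
    simp [h]

/-- The subring of `p`-integral rationals. -/
def SR (p : ℕ) [Fact p.Prime] : Subring ℚ where
  carrier := {q | padicNorm p q ≤ 1}
  mul_mem' := by
    intro a b ha hb
    simp only [Set.mem_ofPred_eq, padicNorm.mul] at *
    exact mul_le_one₀ ha (padicNorm.nonneg _) hb
  one_mem' := by simp
  add_mem' := by
    intro a b ha hb
    exact padicNorm.nonarchimedean.trans (max_le ha hb)
  zero_mem' := by simp
  neg_mem' := by
    intro a ha
    simpa using ha

/-- The subring of `p`-integral polynomials. -/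
def PR (p : ℕ) [Fact p.Prime] : Subring (MvPolynomial (ℕ ⊕ ℕ) ℚ) :=
  (MvPolynomial.map (SR p).subtype).range

lemma mem_PR (p : ℕ) [Fact p.Prime] (P : MvPolynomial (ℕ ⊕ ℕ) ℚ) (h : P ∈ PR p) :
    PIntegralPoly p P := by
  obtain ⟨q, rfl⟩ := h
  intro d
  rw [pint_iff, MvPolynomial.coeff_map]
  exact (q.coeff d).2

lemma X_mem (p : ℕ) [Fact p.Prime] (i : ℕ ⊕ ℕ) : X i ∈ PR p := ⟨X i, by simp⟩

lemma C_mem (p : ℕ) [Fact p.Prime] (q : ℚ) (h : q ∈ SR p) : C q ∈ PR p := ⟨C ⟨q, h⟩, by simp⟩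

lemma aeval_mem (p : ℕ) [Fact p.Prime] {σ : Type*} (f : σ → MvPolynomial (ℕ ⊕ ℕ) ℚ)
    (hf : ∀ i, f i ∈ PR p) (P : MvPolynomial σ ℤ) : aeval f P ∈ PR p := by
  induction P using MvPolynomial.induction_on with
  | C a => simp
  | add a b ha hb => rw [map_add]; exact add_mem ha hb
  | mul_X a i ha => rw [map_mul, aeval_X]; exact mul_mem ha (hf i)

lemma choose_mod (p : ℕ) (hp : p.Prime) (m k : ℕ) (hk : k < p ^ m) :
    (p : ℤ) ∣ ((p ^ m - 1).choose k : ℤ) - (-1) ^ k := by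
  induction k with
  | zero => simp
  | succ k ih =>
    have h1 := ih (by omega)
    have h2 : p ∣ (p ^ m).choose (k + 1) := hp.dvd_choose_pow (by omega) (by omega)
    have h3 : (p ^ m).choose (k + 1) = (p ^ m - 1).choose k + (p ^ m - 1).choose (k + 1) := by
      obtain ⟨N, hN⟩ : ∃ N, p ^ m = N + 1 := ⟨p ^ m - 1, by omega⟩
      rw [hN, Nat.choose_succ_succ]; simp
    have h4 : (p : ℤ) ∣ ((p ^ m).choose (k + 1) : ℤ) := by exact_mod_cast h2
    rw [h3] at h4
    push_cast at h4
    obtain ⟨a, ha⟩ := h4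
    obtain ⟨b, hb⟩ := h1
    exact ⟨a - b, by rw [pow_succ, mul_sub]; linarith⟩

lemma coef_mem (p : ℕ) [Fact p.Prime] (m j : ℕ) (hm : m ≠ 0) (hj : 1 ≤ j) (hjp : j < p) :
    (((p ^ m).choose j : ℚ) / (p : ℚ) ^ m - (-1) ^ (j + 1) / j) / p ∈ SR p := by
  have hp : p.Prime := Fact.out
  have hp0 : (p : ℚ) ≠ 0 := by exact_mod_cast hp.ne_zero
  obtain ⟨k, rfl⟩ : ∃ k, j = k + 1 := ⟨j - 1, by omega⟩
  have hle : p ≤ p ^ m := Nat.le_self_pow hm p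
  obtain ⟨t, ht⟩ := choose_mod p hp m k (by omega)
  have h1 : (k + 1) * (p ^ m).choose (k + 1) = p ^ m * (p ^ m - 1).choose k := by
    obtain ⟨N, hN⟩ : ∃ N, p ^ m = N + 1 := ⟨p ^ m - 1, by omega⟩
    rw [hN]
    have := Nat.add_one_mul_choose_eq N k
    simp only [Nat.add_sub_cancel]
    linarith
  have h1' : ((k : ℚ) + 1) * ((p ^ m).choose (k + 1) : ℚ) =
      (p : ℚ) ^ m * ((p ^ m - 1).choose k : ℚ) := by exact_mod_cast h1
  have ht' : ((p ^ m - 1).choose k : ℚ) - (-1) ^ k = p * t := by exact_mod_cast ht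
  have hk0 : (k : ℚ) + 1 ≠ 0 := by positivity
  have : (((p ^ m).choose (k + 1) : ℚ) / (p : ℚ) ^ m - (-1) ^ (k + 1 + 1) / ((k + 1 : ℕ) : ℚ)) / p
      = (t : ℚ) * (((k + 1 : ℕ) : ℚ))⁻¹ := by
    push_cast
    have h2 : ((p ^ m).choose (k + 1) : ℚ) =
        (p : ℚ) ^ m * ((p ^ m - 1).choose k : ℚ) / ((k : ℚ) + 1) := by
      rw [← h1']; field_simp
    have h3 : ((p ^ m - 1).choose k : ℚ) = p * t + (-1) ^ k := by linarith
    rw [h2, h3]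
    field_simp
    ring
  rw [this]
  refine mul_mem (intCast_mem _ _) ?_
  change padicNorm p _ ≤ 1
  have hn : padicNorm p ((k + 1 : ℕ) : ℚ) = 1 := by
    rw [padicNorm.nat_eq_one_iff]
    intro h
    exact absurd (Nat.le_of_dvd (by omega) h) (by omega)
  rw [← one_div, padicNorm.div, hn]
  simp

lemma Q_mem (p : ℕ) [Fact p.Prime] (Q : ℕ → MvPolynomial (ℕ ⊕ ℕ) ℚ) (hQ : IsQFamily p Q)
    (n : ℕ) : Q n ∈ PR p := by
  have hp0 : (p : MvPolynomial (ℕ ⊕ ℕ) ℚ) ≠ 0 := by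
    exact_mod_cast (Fact.out : p.Prime).ne_zero
  let f : Fin 2 × ℕ → MvPolynomial (ℕ ⊕ ℕ) ℚ :=
    fun x => if x.1 = 0 then Xv x.2 * (1 + Yv x.2) else Xv x.2
  let Φ : MvPolynomial (Fin 2) ℤ := X 0 - X 1
  let q : ℕ → MvPolynomial (ℕ ⊕ ℕ) ℚ := fun i => aeval f (wittStructureInt p Φ i)
  have hq : ∀ n, ∑ i ∈ Finset.range (n + 1),
        (p : MvPolynomial (ℕ ⊕ ℕ) ℚ) ^ i * (Xv i * (1 + Yv i)) ^ p ^ (n - i) =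
      ∑ i ∈ Finset.range (n + 1), (p : MvPolynomial (ℕ ⊕ ℕ) ℚ) ^ i * Xv i ^ p ^ (n - i) +
        ∑ i ∈ Finset.range (n + 1), (p : MvPolynomial (ℕ ⊕ ℕ) ℚ) ^ i * q i ^ p ^ (n - i) := by
    intro n
    have h := congrArg (aeval f) (wittStructureInt_prop p Φ n)
    simp only [Φ, map_sub, aeval_bind₁, bind₁_X_right, aeval_rename, aeval_wittPolynomial] at h
    simp only [f, Function.comp, q, Φ] at h ⊢
    simp at h ⊢
    rw [h]; ring
  have key : ∀ n, Q n = q n := by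
    intro n
    induction n using Nat.strong_induction_on with
    | _ n ih =>
      have h1 := hQ n
      rw [hq n, add_right_inj, Finset.sum_range_succ, Finset.sum_range_succ,
        Finset.sum_congr rfl (fun i hi => by rw [← ih i (Finset.mem_range.1 hi)])] at h1
      simp only [Nat.sub_self, pow_zero, pow_one, add_right_inj] at h1
      exact (mul_left_cancel₀ (pow_ne_zero n hp0) h1).symm
  rw [key]
  apply aeval_mem
  rintro ⟨a, i⟩
  simp only [f]
  split_ifs
  · exact mul_mem (X_mem _ _) (add_mem (one_mem _) (X_mem _ _))
  · exact X_mem _ _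

/-- The ideal of the `Y` variables. -/
abbrev YI (n : ℕ) : Ideal (MvPolynomial (ℕ ⊕ ℕ) ℚ) :=
  Ideal.span {P : MvPolynomial (ℕ ⊕ ℕ) ℚ | ∃ i ≤ n, P = X (Sum.inr i)}

lemma Y_mem {i n : ℕ} (h : i ≤ n) : Yv i ∈ YI n := Ideal.subset_span ⟨i, h, rfl⟩

lemma YI_mono {i n : ℕ} (h : i ≤ n) : YI i ≤ YI n :=
  Ideal.span_mono (by rintro P ⟨j, hj, rfl⟩; exact ⟨j, hj.trans h, rfl⟩)

lemma cancel_p (p : ℕ) (hp : p.Prime) (n : ℕ) (I : Ideal (MvPolynomial (ℕ ⊕ ℕ) ℚ))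
    (P : MvPolynomial (ℕ ⊕ ℕ) ℚ) (h : (p : MvPolynomial (ℕ ⊕ ℕ) ℚ) ^ n * P ∈ I) : P ∈ I := by
  have hp0 : (p : ℚ) ^ n ≠ 0 := pow_ne_zero _ (by exact_mod_cast hp.ne_zero)
  have h2 := I.mul_mem_left (C (((p : ℚ) ^ n)⁻¹)) h
  have h3 : (p : MvPolynomial (ℕ ⊕ ℕ) ℚ) ^ n = C ((p : ℚ) ^ n) := by simp
  rwa [h3, ← mul_assoc, ← C_mul, inv_mul_cancel₀ hp0, C_1, one_mul] at h2

lemma Q_expand (p : ℕ) (Q : ℕ → MvPolynomial (ℕ ⊕ ℕ) ℚ) (hQ : IsQFamily p Q) (n : ℕ) :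
    (p : MvPolynomial (ℕ ⊕ ℕ) ℚ) ^ n * (Q n - Xv n * Yv n) =
      ∑ i ∈ Finset.range n, (p : MvPolynomial (ℕ ⊕ ℕ) ℚ) ^ i *
        (Xv i ^ p ^ (n - i) * ((1 + Yv i) ^ p ^ (n - i) - 1) - Q i ^ p ^ (n - i)) := by
  have h := hQ n
  simp only [Finset.sum_range_succ, Nat.sub_self, pow_zero, pow_one] at h
  simp only [mul_sub, Finset.sum_sub_distrib, mul_one, ← mul_pow]
  linear_combination -h

lemma Q_mem_YI (p : ℕ) (hp : p.Prime) (Q : ℕ → MvPolynomial (ℕ ⊕ ℕ) ℚ) (hQ : IsQFamily p Q)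
    (n : ℕ) : Q n ∈ YI n := by
  induction n using Nat.strong_induction_on with
  | _ n ih =>
    have h1 : Q n - Xv n * Yv n ∈ YI n := by
      apply cancel_p p hp n
      rw [Q_expand p Q hQ]
      refine sum_mem fun i hi => ?_
      have hi := Finset.mem_range.1 hi
      refine Ideal.mul_mem_left _ _ (sub_mem (Ideal.mul_mem_left _ _ ?_) ?_)
      · have := sub_dvd_pow_sub_pow (1 + Yv i) 1 (p ^ (n - i))
        rw [one_pow, add_sub_cancel_left] at this
        exact Ideal.mem_of_dvd _ this (Y_mem hi.le)
      · exact Ideal.pow_mem_of_mem _ (YI_mono hi.le (ih i hi)) _ (pow_pos hp.pos _)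
    have := add_mem h1 ((YI n).mul_mem_left (Xv n) (Y_mem le_rfl))
    simpa using this

lemma trunc (p N i n : ℕ) (hp : 0 < p) (hN : p ≤ N) (h : i ≤ n) :
    ((1 + Yv i) ^ N - 1) - ∑ j ∈ Finset.Icc 1 (p - 1), C (N.choose j : ℚ) * Yv i ^ j ∈
      YI n ^ p := by
  have h1 : (1 + Yv i) ^ N = ∑ j ∈ Finset.range (N + 1), C (N.choose j : ℚ) * Yv i ^ j := by
    rw [add_comm, add_pow]
    refine Finset.sum_congr rfl fun j _ => ?_
    simp [mul_comm]
  have h2 : Finset.range p = insert 0 (Finset.Icc 1 (p - 1)) := by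
    ext j; simp; omega
  rw [h1, ← Finset.sum_range_add_sum_Ico _ (show p ≤ N + 1 by omega), h2,
    Finset.sum_insert (by simp)]
  have h3 : ∑ j ∈ Finset.Ico p (N + 1), C (N.choose j : ℚ) * Yv i ^ j ∈ YI n ^ p := by
    refine sum_mem fun j hj => Ideal.mul_mem_left _ _ ?_
    exact Ideal.pow_le_pow_right (Finset.mem_Ico.1 hj).1 (Ideal.pow_mem_pow (Y_mem h) j)
  convert h3 using 1
  simp
  ring

/-- For every `n ≥ 0`, the element
`Q_n − (Σ_{i=0}^{n−1} X_i^{p^{n−i}}·λ(Y_i) + X_n·Y_n)` of `ℤ_(p)[X_0,…,X_n,Y_0,…,Y_n]`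
lies in the ideal `(p) + (Y_0,…,Y_n)^p`, where `λ(Y) = Σ_{j=1}^{p−1} (−1)^{j+1}·Y^j/j`.
This is expressed by a decomposition `p·A + B` with `A, B` having `p`-integral
coefficients and `B` lying in the `p`-th power of the ideal generated by `Y_0,…,Y_n`. -/
theorem statement4 (p : ℕ) (hp : p.Prime) (hp2 : 2 < p)
    (Q : ℕ → MvPolynomial (ℕ ⊕ ℕ) ℚ) (hQ : IsQFamily p Q) (n : ℕ) :
    ∃ A B : MvPolynomial (ℕ ⊕ ℕ) ℚ,
      PIntegralPoly p A ∧ PIntegralPoly p B ∧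
      B ∈ Ideal.span {P : MvPolynomial (ℕ ⊕ ℕ) ℚ | ∃ i ≤ n, P = X (Sum.inr i)} ^ p ∧
      Q n -
          (∑ i ∈ Finset.range n,
              Xv i ^ p ^ (n - i) *
                ∑ j ∈ Finset.Icc 1 (p - 1), C ((-1 : ℚ) ^ (j + 1) / (j : ℚ)) * Yv i ^ j +
            Xv n * Yv n) =
        (p : MvPolynomial (ℕ ⊕ ℕ) ℚ) * A + B := by
  haveI : Fact p.Prime := ⟨hp⟩
  have hp0 : (p : ℚ) ≠ 0 := by exact_mod_cast hp.ne_zero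
  let c : ℕ → ℕ → ℚ := fun i j => ((p ^ (n - i)).choose j : ℚ) / (p : ℚ) ^ (n - i)
  let T : MvPolynomial (ℕ ⊕ ℕ) ℚ := ∑ i ∈ Finset.range n, Xv i ^ p ^ (n - i) *
    ∑ j ∈ Finset.Icc 1 (p - 1), C (c i j) * Yv i ^ j
  let L : MvPolynomial (ℕ ⊕ ℕ) ℚ := ∑ i ∈ Finset.range n, Xv i ^ p ^ (n - i) *
    ∑ j ∈ Finset.Icc 1 (p - 1), C ((-1 : ℚ) ^ (j + 1) / (j : ℚ)) * Yv i ^ j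
  let A : MvPolynomial (ℕ ⊕ ℕ) ℚ := ∑ i ∈ Finset.range n, Xv i ^ p ^ (n - i) *
    ∑ j ∈ Finset.Icc 1 (p - 1), C ((c i j - (-1 : ℚ) ^ (j + 1) / (j : ℚ)) / p) * Yv i ^ j
  have hpC : (p : MvPolynomial (ℕ ⊕ ℕ) ℚ) = C (p : ℚ) := by simp
  have hTA : T - L = (p : MvPolynomial (ℕ ⊕ ℕ) ℚ) * A := by
    simp only [T, L, A, ← Finset.sum_sub_distrib, Finset.mul_sum]
    refine Finset.sum_congr rfl fun i _ => Finset.sum_congr rfl fun j _ => ?_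
    have : C (c i j) = C ((-1 : ℚ) ^ (j + 1) / (j : ℚ)) + (p : MvPolynomial (ℕ ⊕ ℕ) ℚ) *
        C (σ := ℕ ⊕ ℕ) ((c i j - (-1 : ℚ) ^ (j + 1) / (j : ℚ)) / p) := by
      rw [hpC, ← C_mul, ← C_add, mul_div_cancel₀ _ hp0]
      congr 1; ring
    rw [this]; ring
  have hA : A ∈ PR p := by
    refine sum_mem fun i hi => mul_mem (pow_mem (X_mem _ _) _) (sum_mem fun j hj => ?_)
    have hi := Finset.mem_range.1 hi
    have hj := Finset.mem_Icc.1 hj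
    exact mul_mem (C_mem _ _ (coef_mem p (n - i) j (by omega) (by omega) (by omega)))
      (pow_mem (X_mem _ _) _)
  have hcS : ∀ i < n, ∀ j ∈ Finset.Icc 1 (p - 1), (-1 : ℚ) ^ (j + 1) / (j : ℚ) ∈ SR p := by
    intro i hi j hj
    have hj := Finset.mem_Icc.1 hj
    rw [div_eq_mul_inv]
    refine mul_mem (pow_mem (neg_mem (one_mem _)) _) ?_
    change padicNorm p _ ≤ 1
    have hn : padicNorm p (j : ℚ) = 1 := by
      rw [padicNorm.nat_eq_one_iff]
      intro h
      exact absurd (Nat.le_of_dvd (by omega) h) (by omega)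
    rw [← one_div, padicNorm.div, hn]
    simp
  have hL : L ∈ PR p := by
    refine sum_mem fun i hi => mul_mem (pow_mem (X_mem _ _) _) (sum_mem fun j hj => ?_)
    exact mul_mem (C_mem _ _ (hcS i (Finset.mem_range.1 hi) j hj)) (pow_mem (X_mem _ _) _)
  have hXY : Xv n * Yv n ∈ PR p := mul_mem (X_mem _ _) (X_mem _ _)
  refine ⟨A, Q n - Xv n * Yv n - (L + (p : MvPolynomial (ℕ ⊕ ℕ) ℚ) * A), mem_PR p _ hA,
    mem_PR p _ ?_, ?_, ?_⟩
  · exact sub_mem (sub_mem (Q_mem p Q hQ n) hXY)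
      (add_mem hL (mul_mem (natCast_mem _ _) hA))
  · rw [← hTA, add_sub_cancel]
    change _ ∈ YI n ^ p
    apply cancel_p p hp n
    rw [mul_sub, Q_expand p Q hQ]
    simp only [T]
    rw [Finset.mul_sum, ← Finset.sum_sub_distrib]
    refine sum_mem fun i hi => ?_
    have hi := Finset.mem_range.1 hi
    have hle : p ≤ p ^ (n - i) := Nat.le_self_pow (by omega) p
    have h1 := trunc p (p ^ (n - i)) i n hp.pos hle hi.le
    have h2 : Q i ^ p ^ (n - i) ∈ YI n ^ p :=
      Ideal.pow_le_pow_right hle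
        (Ideal.pow_mem_pow (YI_mono hi.le (Q_mem_YI p hp Q hQ i)) _)
    have h3 : (p : MvPolynomial (ℕ ⊕ ℕ) ℚ) ^ n *
        ∑ j ∈ Finset.Icc 1 (p - 1), C (c i j) * Yv i ^ j =
        (p : MvPolynomial (ℕ ⊕ ℕ) ℚ) ^ i *
        ∑ j ∈ Finset.Icc 1 (p - 1), C ((p ^ (n - i)).choose j : ℚ) * Yv i ^ j := by
      rw [Finset.mul_sum, Finset.mul_sum]
      refine Finset.sum_congr rfl fun j _ => ?_
      rw [← mul_assoc, ← mul_assoc, hpC, ← C_pow, ← C_pow, ← C_mul, ← C_mul]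
      congr 2
      have : (p : ℚ) ^ n = p ^ i * p ^ (n - i) := by rw [← pow_add]; congr 1; omega
      rw [this]
      simp only [c]
      field_simp
    have h4 := Ideal.mul_mem_left _ ((p : MvPolynomial (ℕ ⊕ ℕ) ℚ) ^ i)
      (sub_mem (Ideal.mul_mem_left _ (Xv i ^ p ^ (n - i)) h1) h2)
    convert h4 using 1
    linear_combination (-(Xv i ^ p ^ (n - i))) * h3
  · change Q n - (L + Xv n * Yv n) = _
    ring

end QPoly
end
end

section
/- For every x ∈ K^×, one has ord( u(x)/v(x) − 1 ) ≥ r. -/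
/-!
Setting: `p > 2` a prime, `k` a perfect field of characteristic `p`,
`K = k((t))` the field of formal Laurent series, `ord` the `t`-adic valuation
(with `ord 0 = +∞`, encoded below via the predicate `ordGe`),
`L = k(θ)((t))` with `k(θ) = RatFunc k`.
-/

noncomputable section

namespace LFT

variable {F : Type*} [Field F]

theorem ordGe_iff (x : LaurentSeries F) (N : ℤ) :
    ordGe x N ↔ (N : WithTop ℤ) ≤ HahnSeries.addVal ℤ F x := by
  unfold ordGe
  rw [HahnSeries.addVal_apply]
  by_cases h : x = 0
  · simp [h]
  · rw [← HahnSeries.order_eq_orderTop_of_ne_zero h]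
    simp [h]

theorem le_addVal_iff (x : LaurentSeries F) (N : ℤ) :
    (N : WithTop ℤ) ≤ HahnSeries.addVal ℤ F x ↔ ∀ j < N, x.coeff j = 0 := by
  rw [HahnSeries.addVal_apply]
  constructor
  · intro h j hj
    apply HahnSeries.coeff_eq_zero_of_lt_orderTop
    exact lt_of_lt_of_le (by exact_mod_cast hj) h
  · intro h
    by_cases hx : x = 0
    · simp [hx]
    · rw [← HahnSeries.order_eq_orderTop_of_ne_zero hx]
      by_contra hc
      have hc' : x.order < N := by
        rw [not_le] at hc
        exact_mod_cast hc
      exact (mt HahnSeries.coeff_order_eq_zero.mp hx) (h _ hc')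

theorem addVal_single (n : ℤ) (c : F) (hc : c ≠ 0) :
    HahnSeries.addVal ℤ F (HahnSeries.single n c) = (n : WithTop ℤ) := by
  rw [HahnSeries.addVal_apply, HahnSeries.orderTop_single hc]

theorem wt_cancel (a b : ℤ) (y : WithTop ℤ) (h : ((a + b : ℤ) : WithTop ℤ) ≤ (a : WithTop ℤ) + y) :
    (b : WithTop ℤ) ≤ y := by
  induction y using WithTop.recTopCoe with
  | top => exact le_top
  | coe y =>
    have h2 : a + b ≤ a + y := by exact_mod_cast h
    have : b ≤ y := by omega
    exact_mod_cast this

theorem wt_add (a b : ℤ) (x y : WithTop ℤ) (hx : (a : WithTop ℤ) ≤ x) (hy : (b : WithTop ℤ) ≤ y) :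
    ((a + b : ℤ) : WithTop ℤ) ≤ x + y := by
  rw [WithTop.coe_add]
  exact add_le_add hx hy

theorem main_aux (k : Type*) [Field k]
    (r : ℕ) (hr : 1 ≤ r)
    (u v : LaurentSeries k →+* LaurentSeries (RatFunc k))
    (hv : ∀ (x : LaurentSeries k) (j : ℤ),
      (v x).coeff j = algebraMap k (RatFunc k) (x.coeff j))
    (hu_alg : ∀ c : k,
      u (HahnSeries.single 0 c) = HahnSeries.single 0 (algebraMap k (RatFunc k) c))
    (hu_t : u tt = tt * (1 + tt ^ r * θθ k))
    (hu_cont : ∀ N : ℤ, ∃ M : ℤ, ∀ x : LaurentSeries k, ordGe x M → ordGe (u x) N)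
    (x : LaurentSeries k) (hx : x ≠ 0) :
    ordGe (u x / v x - 1) (r : ℤ) := by
  set V := HahnSeries.addVal ℤ (RatFunc k) with hV
  have hvs : ∀ (n : ℤ) (c : k), v (HahnSeries.single n c) =
      HahnSeries.single n (algebraMap k (RatFunc k) c) := by
    intro n c
    ext j
    rw [hv]
    by_cases h : j = n
    · subst h; simp
    · simp [HahnSeries.coeff_single_of_ne h]
  set e : LaurentSeries (RatFunc k) := tt ^ r * θθ k with he
  have hVe : V e = ((r : ℤ) : WithTop ℤ) := by
    have : e = HahnSeries.single (r : ℤ) RatFunc.X := by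
      rw [he, tt, θθ, HahnSeries.single_pow, HahnSeries.single_mul_single]
      simp
    rw [this, hV, addVal_single _ _ RatFunc.X_ne_zero]
  have hV1e : V (1 + e) = ((0 : ℤ) : WithTop ℤ) := by
    have h1 : V 1 < V e := by
      rw [hVe, AddValuation.map_one]
      exact_mod_cast hr
    rw [AddValuation.map_add_eq_of_lt_left V h1, AddValuation.map_one]
    rfl
  have hVt : V tt = ((1 : ℤ) : WithTop ℤ) := addVal_single _ _ one_ne_zero
  have hVs1 : ∀ n : ℤ, V (HahnSeries.single n 1) = (n : WithTop ℤ) :=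
    fun n => addVal_single _ _ one_ne_zero
  have hmul : ∀ {F : Type _} [Field F] (n : ℤ), (HahnSeries.single (n + 1) 1 : LaurentSeries F) =
      HahnSeries.single n 1 * tt := by
    intro F _ n
    rw [tt, HahnSeries.single_mul_single, one_mul]
  have key : ∀ n : ℤ, u (HahnSeries.single (n + 1) 1) - HahnSeries.single (n + 1) 1 =
      (u (HahnSeries.single n 1) - HahnSeries.single n 1) * (tt * (1 + e)) +
        HahnSeries.single (n + 1) 1 * e := by
    intro n
    rw [hmul n, map_mul, hu_t]
    have := hmul (F := RatFunc k) n
    rw [this]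
    ring
  have hVte : V (tt * (1 + e)) = ((1 : ℤ) : WithTop ℤ) := by
    rw [AddValuation.map_mul, hVt, hV1e]; rfl
  have hA : ∀ n : ℤ, ((n + r : ℤ) : WithTop ℤ) ≤
      V (u (HahnSeries.single n 1) - HahnSeries.single n 1) := by
    intro n
    induction n using Int.induction_on with
    | zero =>
      have : u (HahnSeries.single 0 1) - HahnSeries.single 0 1 = 0 := by
        rw [hu_alg]; simp
      rw [this, AddValuation.map_zero]
      exact le_top
    | succ n ih =>
      rw [key]
      apply V.map_le_add
      · rw [AddValuation.map_mul, hVte]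
        have := wt_add _ 1 _ _ ih le_rfl
        convert this using 2
        ring
      · rw [AddValuation.map_mul, hVe, hVs1]
        exact wt_add _ _ _ _ le_rfl le_rfl
    | pred n ih =>
      have hk := key (-(n : ℤ) - 1)
      rw [sub_add_cancel] at hk
      have hk2 := eq_sub_of_add_eq hk.symm
      apply wt_cancel 1
      rw [← hVte, ← AddValuation.map_mul, mul_comm, hk2]
      apply V.map_le_sub
      · convert ih using 2
        ring
      · rw [AddValuation.map_mul, hVe, hVs1]
        refine le_trans (le_of_eq ?_) (wt_add _ _ _ _ le_rfl le_rfl)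
        congr 1
        ring
  have hB : ∀ (n : ℤ) (c : k), ((n + r : ℤ) : WithTop ℤ) ≤
      V (u (HahnSeries.single n c) - v (HahnSeries.single n c)) := by
    intro n c
    by_cases hc : c = 0
    · simp [hc]
    have h1 : (HahnSeries.single n c : LaurentSeries k) =
        HahnSeries.single 0 c * HahnSeries.single n 1 := by
      rw [HahnSeries.single_mul_single]; simp
    have h2 : u (HahnSeries.single n c) - v (HahnSeries.single n c) =
        HahnSeries.single 0 (algebraMap k (RatFunc k) c) *
          (u (HahnSeries.single n 1) - HahnSeries.single n 1) := by
      rw [h1, map_mul, map_mul, hu_alg, hvs, hvs, map_one (algebraMap k (RatFunc k))]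
      ring
    have hc' : algebraMap k (RatFunc k) c ≠ 0 := by simpa using hc
    rw [h2, AddValuation.map_mul, hV, addVal_single _ _ hc']
    have := wt_add 0 _ _ _ le_rfl (hA n)
    rwa [zero_add] at this
  have hC : ∀ n0 : ℤ, ∀ x : LaurentSeries k, (∀ j < n0, x.coeff j = 0) →
      ((n0 + r : ℤ) : WithTop ℤ) ≤ V (u x - v x) := by
    intro n0
    obtain ⟨M, hM⟩ := hu_cont (n0 + r)
    have main : ∀ d : ℕ, ∀ n : ℤ, n0 ≤ n → max M (n0 + r) ≤ n + d →
        ∀ x : LaurentSeries k, (∀ j < n, x.coeff j = 0) →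
        ((n0 + r : ℤ) : WithTop ℤ) ≤ V (u x - v x) := by
      intro d
      induction d with
      | zero =>
        intro n hn hd x hx
        apply V.map_le_sub
        · rw [hV, ← ordGe_iff]
          apply hM
          rw [ordGe_iff, le_addVal_iff]
          intro j hj
          apply hx
          have := le_max_left M (n0 + r)
          push_cast at hd
          omega
        · rw [hV, le_addVal_iff]
          intro j hj
          rw [hv, hx j, map_zero]
          have := le_max_right M (n0 + r)
          push_cast at hd
          omega
      | succ d ih =>
        intro n hn hd x hx
        have hs : u x - v x = (u (HahnSeries.single n (x.coeff n)) -
            v (HahnSeries.single n (x.coeff n))) +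
            (u (x - HahnSeries.single n (x.coeff n)) -
            v (x - HahnSeries.single n (x.coeff n))) := by
          rw [map_sub, map_sub]; ring
        rw [hs]
        apply V.map_le_add
        · refine le_trans ?_ (hB n _)
          have : n0 + (r : ℤ) ≤ n + r := by omega
          exact_mod_cast this
        · apply ih (n + 1) (by omega) (by push_cast at hd ⊢; omega)
          intro j hj
          rw [HahnSeries.coeff_sub]
          by_cases h : j = n
          · subst h; simp
          · rw [HahnSeries.coeff_single_of_ne h, hx j (by omega), sub_zero]
    intro x hx
    exact main (max M (n0 + r) - n0).toNat n0 le_rfl (by omega) x hx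
  have hvx : v x ≠ 0 := by simpa using hx
  rw [ordGe_iff, ← hV]
  have hVvx : V (v x) = (x.order : WithTop ℤ) := by
    apply le_antisymm
    · by_contra hc
      rw [not_le] at hc
      have h := HahnSeries.coeff_eq_zero_of_lt_orderTop (x := v x) (i := x.order) hc
      rw [hv] at h
      exact (mt HahnSeries.coeff_order_eq_zero.mp hx) (by simpa using h)
    · rw [hV, le_addVal_iff]
      intro j hj
      rw [hv, HahnSeries.coeff_eq_zero_of_lt_order hj, map_zero]
  apply wt_cancel x.order
  rw [← hVvx, ← AddValuation.map_mul]
  have : v x * (u x / v x - 1) = u x - v x := by field_simp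
  rw [this]
  exact hC _ _ fun j hj => HahnSeries.coeff_eq_zero_of_lt_order hj

/-- For every `x ∈ K^×`, one has `ord(u(x)/v(x) − 1) ≥ r`. -/
theorem statement6 (p : ℕ) (hp : p.Prime) (hp2 : 2 < p)
    (k : Type*) [Field k] [PerfectField k] [CharP k p]
    (r : ℕ) (hr : 1 ≤ r)
    (u v : LaurentSeries k →+* LaurentSeries (RatFunc k))
    (hv : ∀ (x : LaurentSeries k) (j : ℤ),
      (v x).coeff j = algebraMap k (RatFunc k) (x.coeff j))
    (hu_alg : ∀ c : k,
      u (HahnSeries.single 0 c) = HahnSeries.single 0 (algebraMap k (RatFunc k) c))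
    (hu_t : u tt = tt * (1 + tt ^ r * θθ k))
    (hu_cont : ∀ N : ℤ, ∃ M : ℤ, ∀ x : LaurentSeries k, ordGe x M → ordGe (u x) N)
    (x : LaurentSeries k) (hx : x ≠ 0) :
    ordGe (u x / v x - 1) (r : ℤ) := by
  exact main_aux k r hr u v hv hu_alg hu_t hu_cont x hx

end LFT
end
end
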